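/- Let s < t be real numbers and for integers n ≥ 0 set m_n = ∫_s^t u^n·e^{−u} du. Then for every integer N ≥ 0, one has e^{−x}·(π(e^{x−s}) − π(e^{x−t})) − ∑_{n=0}^{N} m_n·x^{−(n+1)} = o(x^{−(N+1)}) as x → ∞; that is, e^{−x}·(π(e^{x−s}) − π(e^{x−t})) has the asymptotic expansion ∑_{n=0}^∞ m_n/x^{n+1} as x → ∞. Equivalently, with a = e^{−s} > b = e^{−t} > 0, the function (π(ax) − π(bx))·(log x)/x has the asymptotic expansion ∑_{n=0}^∞ m_n/(log x)^n as x → ∞; in particular (π(ax) − π(bx))·(log x)/x − (a − b) − (a(1 − log a) − b(1 − log b))/log x = o(1/log x). -/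

import Mathlib

open Filter

/-- The prime counting function `π(x)`: the number of primes `p ≤ x`. -/
noncomputable def primePi (x : ℝ) : ℝ := Nat.primeCounting ⌊x⌋₊

section

open Set MeasureTheory Complex

theorem norm_fract_mul_cpow_le (s : ℂ) {u : ℝ} (hu : 0 < u) :
    ‖((Int.fract u : ℝ) : ℂ) * (u : ℂ) ^ (-s - 1)‖ ≤ u ^ (-s.re - 1) := by
  rw [norm_mul, norm_cpow_eq_rpow_re_of_pos hu, norm_real, Real.norm_of_nonneg (Int.fract_nonneg u)]
  simpa using mul_le_mul_of_nonneg_right (Int.fract_lt_one u).le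
    (Real.rpow_nonneg hu.le (-s.re - 1))

theorem integrableOn_fract_mul_cpow {s : ℂ} (hs : 0 < s.re) {a : ℝ} (ha : 0 < a) :
    IntegrableOn (fun u : ℝ ↦ ((Int.fract u : ℝ) : ℂ) * (u : ℂ) ^ (-s - 1)) (Ioi a) := by
  refine (integrableOn_Ioi_rpow_of_lt (by linarith : -s.re - 1 < -1) ha).mono' ?_ ?_
  · exact (by fun_prop : Measurable _).aestronglyMeasurable
  · filter_upwards [ae_restrict_mem measurableSet_Ioi] with u hu
    exact norm_fract_mul_cpow_le s (ha.trans hu)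

theorem differentiableAt_integral_fract_mul_cpow {s : ℂ} (hs : 0 < s.re) {a : ℝ} (ha : 0 < a) :
    DifferentiableAt ℂ
      (fun z : ℂ ↦ ∫ u in Ioi a, ((Int.fract u : ℝ) : ℂ) * (u : ℂ) ^ (-z - 1)) s := by
  have key : (fun z : ℂ ↦ ∫ u in Ioi a, ((Int.fract u : ℝ) : ℂ) * (u : ℂ) ^ (-z - 1)) =
      fun z ↦ mellin (indicator (Ioi a) fun u : ℝ ↦ ((Int.fract u : ℝ) : ℂ)) (-z) := by
    ext z
    simp only [mellin, smul_eq_mul]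
    simp_rw [mul_comm _ (indicator _ _ _),
      ← indicator_mul_left _ _ (fun u : ℝ ↦ (u : ℂ) ^ (-z - 1))]
    rw [setIntegral_indicator measurableSet_Ioi,
      inter_eq_self_of_subset_right (Ioi_subset_Ioi ha.le)]
  rw [key]
  have hm : Measurable (indicator (Ioi a) fun u : ℝ ↦ ((Int.fract u : ℝ) : ℂ)) :=
    (by fun_prop : Measurable _).indicator measurableSet_Ioi
  have hb (u : ℝ) : ‖indicator (Ioi a) (fun u : ℝ ↦ ((Int.fract u : ℝ) : ℂ)) u‖ ≤ 1 := by
    refine (norm_indicator_le_norm_self _ _).trans ?_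
    rw [norm_real, Real.norm_of_nonneg (Int.fract_nonneg u)]
    exact (Int.fract_lt_one u).le
  have hd : DifferentiableAt ℂ
      (mellin (indicator (Ioi a) fun u : ℝ ↦ ((Int.fract u : ℝ) : ℂ))) (-s) := by
    refine mellin_differentiableAt_of_isBigO_rpow (a := 0) (b := -s.re - 1)
      ?_ ?_ (by simpa) ?_ (by simp)
    · refine LocallyIntegrable.locallyIntegrableOn ?_ _
      exact (locallyIntegrable_const (1 : ℝ)).mono hm.aestronglyMeasurable
        (Eventually.of_forall fun u ↦ by simpa using hb u)
    · simpa using Asymptotics.isBigO_of_le (g := fun _ : ℝ ↦ (1 : ℝ)) atTop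
        (fun u ↦ by simpa using hb u)
    · refine Asymptotics.IsBigO.of_bound 0 ?_
      filter_upwards [Ioo_mem_nhdsGT ha] with u hu
      simp [hu.2.le]
  exact hd.comp s differentiableAt_id.neg

theorem riemannZeta_eq_sum_add_integral_of_one_lt_re {N : ℕ} (hN : 1 ≤ N) {s : ℂ} (hs : 1 < s.re) :
    riemannZeta s = ∑ n ∈ Finset.Icc 1 N, (n : ℂ) ^ (-s) + (N : ℂ) ^ (1 - s) / (s - 1)
      - s * ∫ u in Ioi (N : ℝ), ((Int.fract u : ℝ) : ℂ) * (u : ℂ) ^ (-s - 1) := by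
  have hN0 : (0 : ℝ) < N := by exact_mod_cast hN
  have hNc : (N : ℂ) ≠ 0 := by exact_mod_cast hN0.ne'
  have hs0 : s ≠ 0 := by rintro rfl; simp at hs; linarith
  have hs1 : s - 1 ≠ 0 := by intro h; rw [sub_eq_zero.1 h] at hs; simp at hs
  let f : ℕ → ℂ := fun n ↦ if N < n then 1 else 0
  let g : ℕ → ℂ := fun n ↦ if N < n then 0 else 1
  have hg (n : ℕ) (hn : n ∉ Finset.Icc 1 N) : LSeries.term g s n = 0 := by
    rcases eq_or_ne n 0 with rfl | h
    · simp
    · rw [LSeries.term_of_ne_zero h]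
      have : N < n := by simp at hn; lia
      simp [g, this]
  have hgs : LSeriesSummable g s := summable_of_ne_finset_zero (s := Finset.Icc 1 N) hg
  have hg' : LSeries g s = ∑ n ∈ Finset.Icc 1 N, (n : ℂ) ^ (-s) := by
    rw [LSeries, tsum_eq_sum hg]
    refine Finset.sum_congr rfl fun n hn ↦ ?_
    rw [Finset.mem_Icc] at hn
    rw [LSeries.term_of_ne_zero (by lia), cpow_neg]
    simp [g, not_lt.2 hn.2]
  have hfs : LSeriesSummable f s := LSeriesSummable_of_bounded_of_one_lt_re (m := 1)
    (fun n _ ↦ by simp only [f]; split_ifs <;> simp) hs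
  have hsum (m : ℕ) : ∑ k ∈ Finset.Icc 1 m, f k = ((m - N : ℕ) : ℂ) := by
    rw [Finset.sum_ite, Finset.sum_const_zero, add_zero, Finset.sum_const, nsmul_eq_mul, mul_one]
    congr 1
    rw [← Nat.card_Ioc]
    congr 1
    ext k
    simp only [Finset.mem_filter, Finset.mem_Icc, Finset.mem_Ioc]
    lia
  have hzeta : riemannZeta s = LSeries g s + LSeries f s := by
    rw [← LSeries_one_eq_riemannZeta hs, ← LSeries_add hgs hfs]
    congr 1
    ext n
    by_cases h : N < n <;> simp [f, g, h]
  have hf := LSeries_eq_mul_integral f zero_le_one hs hfs (by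
    refine Asymptotics.isBigO_of_le _ fun n ↦ ?_
    rw [hsum]
    simp only [norm_natCast, Real.rpow_one]
    exact_mod_cast Nat.sub_le n N)
  have hint : ∫ t in Ioi (1 : ℝ), (∑ k ∈ Finset.Icc 1 ⌊t⌋₊, f k) * (t : ℂ) ^ (-(s + 1)) =
      ∫ t in Ioi (N : ℝ), ((t : ℂ) ^ (-s) - N * (t : ℂ) ^ (-s - 1)
        - ((Int.fract t : ℝ) : ℂ) * (t : ℂ) ^ (-s - 1)) := by
    rw [setIntegral_eq_of_subset_of_forall_sdiff_eq_zero measurableSet_Ioi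
      (Ioi_subset_Ioi (by exact_mod_cast hN : (1 : ℝ) ≤ N))]
    · refine setIntegral_congr_fun measurableSet_Ioi fun t ht ↦ ?_
      have ht0 : 0 < t := hN0.trans ht
      have hfl : N ≤ ⌊t⌋₊ := Nat.le_floor (le_of_lt ht)
      have e1 : ((⌊t⌋₊ : ℝ) : ℂ) = t - ((Int.fract t : ℝ) : ℂ) := by
        rw [← ofReal_sub, Int.self_sub_fract, natCast_floor_eq_intCast_floor ht0.le]
      have e2 : (t : ℂ) ^ (-s) = t * (t : ℂ) ^ (-s - 1) := by
        rw [cpow_sub _ _ (by exact_mod_cast ht0.ne'), cpow_one]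
        have : (t : ℂ) ≠ 0 := by exact_mod_cast ht0.ne'
        field_simp
      simp only [hsum]
      rw [Nat.cast_sub hfl, e2, show -(s + 1) = -s - 1 by ring]
      push_cast at e1
      rw [e1]
      ring
    · intro t ht
      have : ⌊t⌋₊ ≤ N := by
        have : t ≤ N := by simpa using ht.2
        simpa using Nat.floor_le_floor this
      simp [hsum, Nat.sub_eq_zero_of_le this]
  have i1 : IntegrableOn (fun t : ℝ ↦ (t : ℂ) ^ (-s)) (Ioi (N : ℝ)) :=
    integrableOn_Ioi_cpow_of_lt (by simpa using hs) hN0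
  have i2 : IntegrableOn (fun t : ℝ ↦ (t : ℂ) ^ (-s - 1)) (Ioi (N : ℝ)) :=
    integrableOn_Ioi_cpow_of_lt (by simp; linarith) hN0
  have i3 := integrableOn_fract_mul_cpow (s := s) (by linarith) hN0
  rw [hzeta, hg', hf, hint, integral_sub (by exact i1.sub (i2.const_mul (N : ℂ))) i3,
    integral_sub i1 (i2.const_mul _), integral_const_mul,
    integral_Ioi_cpow_of_lt (by simpa using hs) hN0,
    integral_Ioi_cpow_of_lt (by simp; linarith) hN0]
  have e3 : (N : ℂ) ^ (1 - s) = N * (N : ℂ) ^ (-s) := by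
    rw [show 1 - s = -s + 1 by ring, cpow_add _ _ hNc, cpow_one, mul_comm]
  have hs2 : -s + 1 ≠ 0 := by rw [neg_add_eq_sub, ← neg_sub]; exact neg_ne_zero.2 hs1
  rw [show -s - 1 + 1 = -s by ring, ofReal_natCast, show (N : ℂ) ^ (-s + 1) = N * (N : ℂ) ^ (-s) by
    rw [cpow_add _ _ hNc, cpow_one, mul_comm], e3]
  field_simp
  ring

theorem riemannZeta_eq_sum_add_integral {N : ℕ} (hN : 1 ≤ N) {s : ℂ} (hs : 0 < s.re) (hs1 : s ≠ 1) :
    riemannZeta s = ∑ n ∈ Finset.Icc 1 N, (n : ℂ) ^ (-s) + (N : ℂ) ^ (1 - s) / (s - 1)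
      - s * ∫ u in Ioi (N : ℝ), ((Int.fract u : ℝ) : ℂ) * (u : ℂ) ^ (-s - 1) := by
  have hN0 : (N : ℂ) ≠ 0 := by exact_mod_cast (by lia : N ≠ 0)
  let R : ℂ → ℂ := fun s ↦ (s - 1) * (∑ n ∈ Finset.Icc 1 N, (n : ℂ) ^ (-s)
      - s * ∫ u in Ioi (N : ℝ), ((Int.fract u : ℝ) : ℂ) * (u : ℂ) ^ (-s - 1)) + (N : ℂ) ^ (1 - s)
  let U : Set ℂ := {s | 0 < s.re}
  have hU : IsOpen U := isOpen_lt continuous_const continuous_re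
  have hR : DifferentiableOn ℂ R U := by
    intro z hz
    have h1 : DifferentiableAt ℂ (fun s : ℂ ↦ ∑ n ∈ Finset.Icc 1 N, (n : ℂ) ^ (-s)) z := by
      refine DifferentiableAt.fun_sum fun n hn ↦ ?_
      have : (n : ℂ) ≠ 0 := by
        exact_mod_cast (by have := (Finset.mem_Icc.1 hn).1; lia : n ≠ 0)
      exact differentiableAt_id.neg.const_cpow (Or.inl this)
    have h2 := differentiableAt_integral_fract_mul_cpow (s := z) hz
      (a := (N : ℝ)) (by exact_mod_cast hN)
    have h3 : DifferentiableAt ℂ (fun s : ℂ ↦ (N : ℂ) ^ (1 - s)) z :=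
      (differentiableAt_id.const_sub 1).const_cpow (Or.inl hN0)
    exact (((differentiableAt_id.sub_const 1).mul (h1.sub (differentiableAt_id.mul h2))).add
      h3).differentiableWithinAt
  have heq : EqOn riemannZeta₁ R U := by
    refine (differentiable_riemannZeta₁.differentiableOn.analyticOnNhd hU
      ).eqOn_of_preconnected_of_eventuallyEq
      (hR.analyticOnNhd hU) (convex_halfSpace_re_gt 0).isPreconnected (z₀ := 2) (by simp [U]) ?_
    have : {s : ℂ | 1 < s.re} ∈ nhds (2 : ℂ) :=
      (isOpen_lt continuous_const continuous_re).mem_nhds (by simp)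
    filter_upwards [this] with z hz
    have hz1 : z ≠ 1 := by rintro rfl; simp at hz
    have hz2 := sub_ne_zero.2 hz1
    have e := riemannZeta_eq_inv_sub_mul hz1
    rw [riemannZeta_eq_sum_add_integral_of_one_lt_re hN hz] at e
    simp only [R]
    field_simp at e
    rw [← e]; ring
  have e := heq (x := s) hs
  rw [riemannZeta_eq_inv_sub_mul hs1, e]
  have hz2 := sub_ne_zero.2 hs1
  simp only [R]
  field_simp
  ring

theorem sum_Icc_rpow_neg_le {σ ε : ℝ} (hε : 0 < ε) (hσ : 1 - ε ≤ σ) {N : ℕ} (hN : 1 ≤ N) :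
    ∑ n ∈ Finset.Icc 1 N, (n : ℝ) ^ (-σ) ≤ (1 / ε + 1) * (N : ℝ) ^ (2 * ε) := by
  have hN1 : (1 : ℝ) ≤ N := by exact_mod_cast hN
  have h1 : ∑ n ∈ Finset.Icc 1 N, (n : ℝ) ^ (-σ) ≤
      ∑ n ∈ Finset.Icc 1 N, (N : ℝ) ^ ε * (n : ℝ)⁻¹ := by
    refine Finset.sum_le_sum fun n hn ↦ ?_
    rw [Finset.mem_Icc] at hn
    have hn1 : (1 : ℝ) ≤ n := by exact_mod_cast hn.1
    calc (n : ℝ) ^ (-σ) ≤ (n : ℝ) ^ (ε - 1) :=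
          Real.rpow_le_rpow_of_exponent_le hn1 (by linarith)
      _ = (n : ℝ) ^ ε * (n : ℝ)⁻¹ := by rw [Real.rpow_sub_one (by positivity), div_eq_mul_inv]
      _ ≤ _ := by gcongr; exact_mod_cast hn.2
  have h2 : ∑ n ∈ Finset.Icc 1 N, (n : ℝ)⁻¹ ≤ 1 + Real.log N := by
    have := harmonic_le_one_add_log N
    rw [harmonic_eq_sum_Icc] at this
    push_cast at this
    exact this
  have h3 : Real.log N ≤ (N : ℝ) ^ ε / ε := Real.log_le_rpow_div (by positivity) hε
  have h4 : 1 ≤ (N : ℝ) ^ ε := Real.one_le_rpow hN1 hε.le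
  rw [← Finset.mul_sum] at h1
  calc _ ≤ (N : ℝ) ^ ε * ∑ n ∈ Finset.Icc 1 N, (n : ℝ)⁻¹ := h1
    _ ≤ (N : ℝ) ^ ε * ((N : ℝ) ^ ε + (N : ℝ) ^ ε / ε) := by gcongr; linarith
    _ = (1 / ε + 1) * ((N : ℝ) ^ ε * (N : ℝ) ^ ε) := by ring
    _ = _ := by rw [← Real.rpow_add (by positivity), two_mul]

theorem norm_integral_fract_mul_cpow_le {s : ℂ} (hs : 0 < s.re) {a : ℝ} (ha : 0 < a) :
    ‖∫ u in Ioi a, ((Int.fract u : ℝ) : ℂ) * (u : ℂ) ^ (-s - 1)‖ ≤ a ^ (-s.re) / s.re := by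
  refine (norm_integral_le_of_norm_le
    (integrableOn_Ioi_rpow_of_lt (by linarith : -s.re - 1 < -1) ha) ?_).trans_eq ?_
  · filter_upwards [ae_restrict_mem measurableSet_Ioi] with u hu
    exact norm_fract_mul_cpow_le s (ha.trans hu)
  · rw [integral_Ioi_rpow_of_lt (by linarith) ha, sub_add_cancel, neg_div_neg_eq]

theorem rpow_le_two_mul_rpow {a b ε : ℝ} (ha : 0 ≤ a) (hab : a ≤ 2 * b) (hε : 0 ≤ ε) (hε1 : ε ≤ 1) :
    a ^ ε ≤ 2 * b ^ ε := by
  calc a ^ ε ≤ (2 * b) ^ ε := by gcongr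
    _ = 2 ^ ε * b ^ ε := Real.mul_rpow (by norm_num) (by linarith)
    _ ≤ 2 ^ (1 : ℝ) * b ^ ε := by
      have : 0 ≤ b := by linarith
      gcongr
      norm_num
    _ = _ := by rw [Real.rpow_one]

theorem exists_norm_riemannZeta_le {ε : ℝ} (hε : 0 < ε) (hε1 : ε ≤ 1) :
    ∃ C : ℝ, 0 < C ∧ ∀ s : ℂ, 1 - ε / 2 ≤ s.re → 1 ≤ |s.im| → ‖riemannZeta s‖ ≤ C * |s.im| ^ ε := by
  refine ⟨2 * (2 / ε + 5), by positivity, fun s hs ht ↦ ?_⟩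
  set T := |s.im| with hT
  let N := ⌈T⌉₊
  have hTN : T ≤ N := Nat.le_ceil T
  have hNT : (N : ℝ) ≤ 2 * T := by
    have := Nat.ceil_lt_add_one (show 0 ≤ T by linarith)
    linarith
  have hN1 : (1 : ℝ) ≤ N := ht.trans hTN
  have hN : 1 ≤ N := by exact_mod_cast hN1
  have hre : 0 < s.re := by linarith
  have hs1 : s ≠ 1 := by rintro rfl; simp [hT] at ht; linarith
  have hpow : (N : ℝ) ^ (1 - s.re) ≤ (N : ℝ) ^ ε :=
    Real.rpow_le_rpow_of_exponent_le hN1 (by linarith)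
  have hsum : ‖∑ n ∈ Finset.Icc 1 N, (n : ℂ) ^ (-s)‖ ≤ (2 / ε + 1) * (N : ℝ) ^ ε := by
    calc _ ≤ ∑ n ∈ Finset.Icc 1 N, ‖(n : ℂ) ^ (-s)‖ := norm_sum_le _ _
      _ = ∑ n ∈ Finset.Icc 1 N, (n : ℝ) ^ (-s.re) := by
        refine Finset.sum_congr rfl fun n hn ↦ ?_
        rw [norm_natCast_cpow_of_pos (by rw [Finset.mem_Icc] at hn; lia), neg_re]
      _ ≤ (1 / (ε / 2) + 1) * (N : ℝ) ^ (2 * (ε / 2)) := sum_Icc_rpow_neg_le (by positivity) hs hN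
      _ = _ := by rw [mul_div_cancel₀ _ two_ne_zero, one_div_div]
  have hmid : ‖(N : ℂ) ^ (1 - s) / (s - 1)‖ ≤ (N : ℝ) ^ ε := by
    rw [norm_div, norm_natCast_cpow_of_pos hN]
    have : 1 ≤ ‖s - 1‖ := ht.trans (by simpa using abs_im_le_norm (s - 1))
    refine (div_le_self (by positivity) this).trans ?_
    simpa using hpow
  have hint : ‖s * ∫ u in Ioi (N : ℝ), ((Int.fract u : ℝ) : ℂ) * (u : ℂ) ^ (-s - 1)‖
      ≤ 3 * (N : ℝ) ^ ε := by
    have h1 : ‖s‖ / s.re ≤ 3 * N := by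
      rw [div_le_iff₀ hre]
      have h2 : ‖s‖ ≤ s.re + T := by simpa [abs_of_pos hre] using norm_le_abs_re_add_abs_im s
      nlinarith
    rw [norm_mul]
    calc _ ≤ ‖s‖ * ((N : ℝ) ^ (-s.re) / s.re) := by
          gcongr
          exact norm_integral_fract_mul_cpow_le hre (by positivity)
      _ = ‖s‖ / s.re * (N : ℝ) ^ (-s.re) := by ring
      _ ≤ 3 * N * (N : ℝ) ^ (-s.re) := by gcongr
      _ = 3 * (N : ℝ) ^ (1 - s.re) := by
        rw [sub_eq_add_neg, Real.rpow_add (by positivity), Real.rpow_one]; ring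
      _ ≤ _ := by gcongr
  have hfin : (N : ℝ) ^ ε ≤ 2 * T ^ ε := rpow_le_two_mul_rpow (by positivity) hNT hε.le hε1
  rw [riemannZeta_eq_sum_add_integral hN hre hs1]
  calc _ ≤ (2 / ε + 1) * (N : ℝ) ^ ε + (N : ℝ) ^ ε + 3 * (N : ℝ) ^ ε :=
        (norm_sub_le _ _).trans (add_le_add ((norm_add_le _ _).trans (add_le_add hsum hmid)) hint)
    _ = (2 / ε + 5) * (N : ℝ) ^ ε := by ring
    _ ≤ (2 / ε + 5) * (2 * T ^ ε) := by gcongr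
    _ = _ := by ring

theorem exists_norm_deriv_riemannZeta_le {ε : ℝ} (hε : 0 < ε) (hε1 : ε ≤ 1) :
    ∃ D : ℝ, 0 < D ∧ ∀ s : ℂ, 1 - ε / 4 ≤ s.re → 2 ≤ |s.im| →
      ‖deriv riemannZeta s‖ ≤ D * |s.im| ^ ε := by
  obtain ⟨C, hC, h⟩ := exists_norm_riemannZeta_le hε hε1
  refine ⟨C * 2 / (ε / 4), by positivity, fun s hs ht ↦ ?_⟩
  have hball (z : ℂ) (hz : z ∈ Metric.closedBall s (ε / 4)) :
      1 - ε / 2 ≤ z.re ∧ 1 ≤ |z.im| ∧ |z.im| ≤ 2 * |s.im| := by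
    rw [Metric.mem_closedBall, dist_eq] at hz
    have h1 := (abs_re_le_norm _).trans hz
    have h2 := (abs_im_le_norm _).trans hz
    rw [sub_re, abs_le] at h1
    rw [sub_im] at h2
    have h3 := abs_sub_abs_le_abs_sub z.im s.im
    have h4 := abs_sub_abs_le_abs_sub s.im z.im
    rw [abs_sub_comm] at h4
    refine ⟨by linarith, by linarith, by linarith⟩
  have := norm_deriv_le_of_forall_mem_sphere_norm_le (c := s) (R := ε / 4) (f := riemannZeta)
    (C := C * (2 * |s.im| ^ ε)) (by positivity) ?_ fun z hz ↦ ?_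
  · exact this.trans_eq (by ring)
  · refine DifferentiableOn.diffContOnCl fun z hz ↦ ?_
    have hz' := hball z (Metric.closure_ball_subset_closedBall hz)
    refine (differentiableAt_riemannZeta ?_).differentiableWithinAt
    rintro rfl
    have := hz'.2.1
    norm_num at this
  · obtain ⟨h1, h2, h3⟩ := hball z (Metric.sphere_subset_closedBall hz)
    refine (h z h1 h2).trans ?_
    gcongr
    exact rpow_le_two_mul_rpow (abs_nonneg _) h3 hε.le hε1

theorem exists_norm_riemannZeta_one_add_le :
    ∃ A : ℝ, 0 < A ∧ ∀ x : ℝ, 0 < x → x ≤ 2 → ‖riemannZeta (1 + x)‖ ≤ A / x := by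
  obtain ⟨A, hA⟩ := (isCompact_Icc (a := (0 : ℝ)) (b := 2)).exists_bound_of_continuousOn
    (f := fun x : ℝ ↦ riemannZeta₁ (1 + x))
    (differentiable_riemannZeta₁.continuous.comp (by fun_prop)).continuousOn
  have hA0 : 0 < A := one_pos.trans_le (by simpa using hA 0 (by simp))
  refine ⟨A, hA0, fun x hx hx2 ↦ ?_⟩
  rw [riemannZeta_eq_inv_sub_mul (by simpa using hx.ne'), norm_mul, norm_inv, add_sub_cancel_left,
    norm_real, Real.norm_of_nonneg hx.le, div_eq_inv_mul]
  gcongr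
  exact hA x ⟨hx.le, hx2⟩

theorem one_le_norm_riemannZeta_product {x : ℝ} (hx : 0 < x) (y : ℝ) :
    1 ≤ ‖riemannZeta (1 + x)‖ ^ 3 * ‖riemannZeta (1 + x + I * y)‖ ^ 4 *
      ‖riemannZeta (1 + x + 2 * I * y)‖ := by
  simpa [DirichletCharacter.LFunctionTrivChar, DirichletCharacter.LFunction_modOne_eq] using
    DirichletCharacter.norm_LFunction_product_ge_one (1 : DirichletCharacter ℂ 1) hx y

theorem exists_le_norm_riemannZeta_pow_four {ε : ℝ} (hε : 0 < ε) (hε1 : ε ≤ 1) :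
    ∃ c : ℝ, 0 < c ∧ ∀ s : ℂ, 1 < s.re → s.re ≤ 3 → 1 ≤ |s.im| →
      c * (s.re - 1) ^ 3 * |s.im| ^ (-ε) ≤ ‖riemannZeta s‖ ^ 4 := by
  obtain ⟨A, hA, h1⟩ := exists_norm_riemannZeta_one_add_le
  obtain ⟨C, hC, h2⟩ := exists_norm_riemannZeta_le hε hε1
  refine ⟨1 / (A ^ 3 * (C * 2)), by positivity, fun s hs hs3 ht ↦ ?_⟩
  obtain ⟨x, hx⟩ : ∃ x : ℝ, x = s.re - 1 := ⟨_, rfl⟩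
  have hs' : s = 1 + x + I * s.im := by apply Complex.ext <;> simp [hx]
  have hx0 : 0 < x := by linarith
  have hT : 0 < |s.im| := by linarith
  have key := one_le_norm_riemannZeta_product hx0 s.im
  rw [← hs'] at key
  have h3 := h1 x hx0 (by linarith)
  have h4 : ‖riemannZeta (1 + x + 2 * I * s.im)‖ ≤ C * (2 * |s.im| ^ ε) := by
    refine (h2 _ (by simp; linarith) (by simp [abs_mul]; linarith)).trans ?_
    gcongr
    exact rpow_le_two_mul_rpow (abs_nonneg _) (by simp [abs_mul]) hε.le hε1
  have h5 : 1 ≤ (A / x) ^ 3 * ‖riemannZeta s‖ ^ 4 * (C * (2 * |s.im| ^ ε)) :=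
    key.trans (by gcongr)
  rw [← hx, Real.rpow_neg hT.le]
  have hTε : 0 < |s.im| ^ ε := by positivity
  rw [show 1 / (A ^ 3 * (C * 2)) * x ^ 3 * (|s.im| ^ ε)⁻¹ =
    1 / ((A / x) ^ 3 * (C * (2 * |s.im| ^ ε))) by field_simp, div_le_iff₀ (by positivity)]
  linarith

theorem exists_le_norm_riemannZeta {ε : ℝ} (hε : 0 < ε) (hε1 : ε ≤ 1) :
    ∃ κ c : ℝ, 0 < κ ∧ κ ≤ ε / 4 ∧ 0 < c ∧ ∀ s : ℂ, 1 - κ * |s.im| ^ (-(5 * ε)) ≤ s.re →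
      s.re ≤ 3 → 2 ≤ |s.im| → c * |s.im| ^ (-(4 * ε)) ≤ ‖riemannZeta s‖ := by
  obtain ⟨c, hc, h1⟩ := exists_le_norm_riemannZeta_pow_four hε hε1
  obtain ⟨D, hD, h2⟩ := exists_norm_deriv_riemannZeta_le hε hε1
  obtain ⟨κ, hκ, hκε, hκc⟩ : ∃ κ : ℝ, 0 < κ ∧ κ ≤ ε / 4 ∧ κ * (4 * D) ^ 4 ≤ c :=
    ⟨min (ε / 4) (c / (4 * D) ^ 4), by positivity, min_le_left _ _, by
      rw [← le_div_iff₀ (by positivity)]; exact min_le_right _ _⟩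
  refine ⟨κ, 2 * D * κ, hκ, hκε, by positivity, fun s hs hs3 ht ↦ ?_⟩
  set T := |s.im| with hTdef
  have hT : 0 < T := by linarith
  set X := T ^ ε with hX
  have hX1 : 1 ≤ X := Real.one_le_rpow (by linarith) hε.le
  have hX0 : 0 < X := by positivity
  have e4 : T ^ (-(4 * ε)) = 1 / X ^ 4 := by
    rw [Real.rpow_neg hT.le, hX, ← Real.rpow_natCast, ← Real.rpow_mul hT.le, mul_comm, one_div]
    norm_num
  have e5 : T ^ (-(5 * ε)) = 1 / X ^ 5 := by
    rw [Real.rpow_neg hT.le, hX, ← Real.rpow_natCast, ← Real.rpow_mul hT.le, mul_comm, one_div]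
    norm_num
  have e1 : T ^ (-ε) = 1 / X := by rw [Real.rpow_neg hT.le, one_div]
  rw [e5] at hs
  rw [e4]
  set δ := κ * (1 / X ^ 5) with hδ
  have hδ0 : 0 < δ := by positivity
  have hδκ : δ ≤ κ := by
    rw [hδ, mul_one_div]
    exact div_le_self hκ.le (one_le_pow₀ hX1)
  have right (z : ℂ) (hz : 1 + δ ≤ z.re) (hz3 : z.re ≤ 3) (hzi : z.im = s.im) :
      4 * D * δ * X ≤ ‖riemannZeta z‖ := by
    have h := h1 z (by linarith) hz3 (by rw [hzi]; linarith)
    rw [hzi, ← hTdef, e1] at h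
    have h3 : c * δ ^ 3 * (1 / X) ≤ ‖riemannZeta z‖ ^ 4 := by
      refine le_trans ?_ h
      gcongr
      linarith
    refine le_of_pow_le_pow_left₀ (n := 4) (by norm_num) (norm_nonneg _) (le_trans ?_ h3)
    calc (4 * D * δ * X) ^ 4 = κ * (4 * D) ^ 4 * δ ^ 3 * (1 / X) := by
          rw [hδ]; field_simp
      _ ≤ _ := by gcongr
  have hgoal : 2 * D * κ * (1 / X ^ 4) = 2 * D * δ * X := by rw [hδ]; field_simp
  rw [hgoal]
  rcases le_or_gt (1 + δ) s.re with hsδ | hsδ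
  · refine le_trans ?_ (right s hsδ hs3 rfl)
    gcongr
    norm_num
  · let w : ℂ := ⟨1 + δ, s.im⟩
    have hw := right w le_rfl (by simp only [w]; linarith) rfl
    let S : Set ℂ := {z | 1 - ε / 4 ≤ z.re} ∩ {z | z.im = s.im}
    have hS : Convex ℝ S := by
      refine (convex_halfSpace_re_ge _).inter ?_
      exact (convex_singleton s.im).is_linear_preimage imLm.isLinear
    have hS1 (z : ℂ) (hz : z ∈ S) : ‖deriv riemannZeta z‖ ≤ D * X := by
      have h := h2 z hz.1 (by rw [hz.2]; exact ht)
      rwa [hz.2] at h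
    have hS2 (z : ℂ) (hz : z ∈ S) : DifferentiableAt ℂ riemannZeta z := by
      refine differentiableAt_riemannZeta ?_
      rintro rfl
      have : T = 0 := by rw [hTdef, ← hz.2]; simp
      linarith
    have hsw := hS.norm_image_sub_le_of_norm_deriv_le (x := s) (y := w) hS2 hS1
      ⟨by simp only [mem_ofPred_eq]; linarith, rfl⟩ ⟨by simp only [mem_ofPred_eq, w]; linarith, rfl⟩
    have hn : ‖w - s‖ ≤ 2 * δ := by
      have : w - s = ((1 + δ - s.re : ℝ) : ℂ) := by apply Complex.ext <;> simp [w]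
      rw [this, norm_real, Real.norm_of_nonneg (by linarith)]
      linarith
    have h3 : ‖riemannZeta w‖ - ‖riemannZeta s‖ ≤ D * X * (2 * δ) :=
      (norm_sub_norm_le _ _).trans (hsw.trans (by gcongr))
    linarith

/-- The holomorphic continuation of `-deriv ζ / ζ - ζ` to a neighbourhood of `1 ≤ re s`. -/
noncomputable def negLogDerivZetaSubZeta (s : ℂ) : ℂ :=
  -deriv riemannZeta₁ s / riemannZeta₁ s - riemannZeta₀ s

theorem negLogDerivZetaSubZeta_eq {s : ℂ} (hs : s ≠ 1) (hζ : riemannZeta s ≠ 0) :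
    negLogDerivZetaSubZeta s = -deriv riemannZeta s / riemannZeta s - riemannZeta s := by
  have h0 := sub_ne_zero.2 hs
  have h1 : riemannZeta₁ s ≠ 0 := by
    intro h; rw [riemannZeta_eq_inv_sub_mul hs, h, mul_zero] at hζ; exact hζ rfl
  have h2 : -deriv riemannZeta s / riemannZeta s =
      (s - 1)⁻¹ - deriv riemannZeta₁ s / riemannZeta₁ s := by
    rw [deriv_riemannZeta_eq_neg_inv_sub_sq_mul_add hs, riemannZeta_eq_inv_sub_mul hs]
    field_simp
    ring
  rw [h2, riemannZeta_eq_inv_sub_add hs, negLogDerivZetaSubZeta]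
  ring

theorem differentiableAt_negLogDerivZetaSubZeta {s : ℂ} (hs : riemannZeta₁ s ≠ 0) :
    DifferentiableAt ℂ negLogDerivZetaSubZeta s :=
  ((differentiable_riemannZeta₁.deriv s).neg.div (differentiable_riemannZeta₁ s) hs).sub
    (differentiable_riemannZeta₀ s)

theorem riemannZeta₁_ne_zero_of_one_le_re {s : ℂ} (hs : 1 ≤ s.re) : riemannZeta₁ s ≠ 0 := by
  rcases eq_or_ne s 1 with rfl | h
  · simp
  · intro h0
    have := riemannZeta_ne_zero_of_one_le_re hs
    rw [riemannZeta_eq_inv_sub_mul h, h0, mul_zero] at this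
    exact this rfl

theorem exists_norm_negLogDerivZetaSubZeta_le {ε : ℝ} (hε : 0 < ε) (hε1 : ε ≤ 1) :
    ∃ κ C : ℝ, 0 < κ ∧ κ ≤ 1 / 4 ∧ 0 < C ∧ ∀ s : ℂ, 1 - κ * |s.im| ^ (-(5 * ε)) ≤ s.re →
      s.re ≤ 3 → 2 ≤ |s.im| → riemannZeta₁ s ≠ 0 ∧
        ‖negLogDerivZetaSubZeta s‖ ≤ C * |s.im| ^ (5 * ε) := by
  obtain ⟨κ, c, hκ, hκε, hc, h1⟩ := exists_le_norm_riemannZeta hε hε1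
  obtain ⟨D, hD, h2⟩ := exists_norm_deriv_riemannZeta_le hε hε1
  obtain ⟨C, hC, h3⟩ := exists_norm_riemannZeta_le hε hε1
  refine ⟨κ, D / c + C, hκ, by linarith, by positivity, fun s hs hs3 ht ↦ ?_⟩
  have hT : 0 < |s.im| := by linarith
  have hs1 : s ≠ 1 := by rintro rfl; simp at hT
  have hre : 1 - ε / 4 ≤ s.re := by
    have : |s.im| ^ (-(5 * ε)) ≤ 1 :=
      Real.rpow_le_one_of_one_le_of_nonpos (by linarith) (by linarith)
    nlinarith
  have hlow := h1 s hs hs3 ht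
  have hpos : 0 < c * |s.im| ^ (-(4 * ε)) := by positivity
  have hζ : riemannZeta s ≠ 0 := norm_pos_iff.1 (hpos.trans_le hlow)
  refine ⟨fun h ↦ hζ (by rw [riemannZeta_eq_inv_sub_mul hs1, h, mul_zero]), ?_⟩
  rw [negLogDerivZetaSubZeta_eq hs1 hζ]
  calc _ ≤ ‖deriv riemannZeta s‖ / ‖riemannZeta s‖ + ‖riemannZeta s‖ := by
        simpa using norm_sub_le (-deriv riemannZeta s / riemannZeta s) (riemannZeta s)
    _ ≤ D * |s.im| ^ ε / (c * |s.im| ^ (-(4 * ε))) + C * |s.im| ^ ε := by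
        gcongr
        · exact h2 s hre ht
        · exact h3 s (by linarith) (by linarith)
    _ = D / c * |s.im| ^ (5 * ε) + C * |s.im| ^ ε := by
        rw [show 5 * ε = ε + 4 * ε by ring, Real.rpow_add hT, Real.rpow_neg hT.le]
        field_simp
    _ ≤ D / c * |s.im| ^ (5 * ε) + C * |s.im| ^ (5 * ε) := by
        gcongr
        · linarith
        · linarith
    _ = _ := by ring

theorem exists_norm_iteratedDeriv_negLogDerivZetaSubZeta_le_of_three_le (K : ℕ) :
    ∃ C : ℝ, 0 < C ∧ ∀ s : ℂ, 1 < s.re → s.re ≤ 2 → 3 ≤ |s.im| →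
      ‖iteratedDeriv K negLogDerivZetaSubZeta s‖ ≤ C * |s.im| ^ (1 / 2 : ℝ) := by
  set ε : ℝ := 1 / (10 * (K + 1)) with hεdef
  have hε : 0 < ε := by positivity
  have hε1 : ε ≤ 1 := by
    rw [hεdef, div_le_one (by positivity)]
    have : (0 : ℝ) ≤ K := by positivity
    linarith
  have hεK : 5 * ε * (K + 1) = 1 / 2 := by rw [hεdef]; field_simp; norm_num
  obtain ⟨κ, C, hκ, hκ1, hC, h⟩ := exists_norm_negLogDerivZetaSubZeta_le hε hε1
  refine ⟨K.factorial * C / κ ^ K * 2, by positivity, fun s hs hs2 ht ↦ ?_⟩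
  have hT : 0 < 2 * |s.im| := by linarith
  set R := κ * (2 * |s.im|) ^ (-(5 * ε)) with hR
  have hR0 : 0 < R := by positivity
  have hR1 : R ≤ 1 / 4 := by
    have : (2 * |s.im|) ^ (-(5 * ε)) ≤ 1 :=
      Real.rpow_le_one_of_one_le_of_nonpos (by linarith) (by linarith)
    nlinarith
  have hball (z : ℂ) (hz : z ∈ Metric.closedBall s R) :
      1 - κ * |z.im| ^ (-(5 * ε)) ≤ z.re ∧ z.re ≤ 3 ∧ 2 ≤ |z.im| ∧ |z.im| ≤ 2 * |s.im| := by
    rw [Metric.mem_closedBall, dist_eq] at hz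
    have h1 := (abs_re_le_norm _).trans hz
    have h2 := (abs_im_le_norm _).trans hz
    rw [sub_re, abs_le] at h1
    rw [sub_im] at h2
    have h3 := abs_sub_abs_le_abs_sub z.im s.im
    have h4 := abs_sub_abs_le_abs_sub s.im z.im
    rw [abs_sub_comm] at h4
    have h5 : |z.im| ≤ 2 * |s.im| := by linarith
    have h6 : R ≤ κ * |z.im| ^ (-(5 * ε)) := by
      rw [hR]
      gcongr ?_ * ?_
      exact Real.rpow_le_rpow_of_nonpos (by linarith) h5 (by linarith)
    exact ⟨by linarith, by linarith, by linarith, h5⟩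
  have := norm_iteratedDeriv_le_of_forall_mem_sphere_norm_le (c := s) (R := R)
    (f := negLogDerivZetaSubZeta) (C := C * (2 * |s.im|) ^ (5 * ε)) K hR0 ?_ fun z hz ↦ ?_
  · refine this.trans ?_
    have e : (2 * |s.im|) ^ (5 * ε) / ((2 * |s.im|) ^ (-(5 * ε))) ^ K =
        (2 * |s.im|) ^ (1 / 2 : ℝ) := by
      rw [← hεK, ← Real.rpow_natCast, ← Real.rpow_mul hT.le, ← Real.rpow_sub hT]
      congr 1
      ring
    calc _ = K.factorial * C / κ ^ K *
          ((2 * |s.im|) ^ (5 * ε) / ((2 * |s.im|) ^ (-(5 * ε))) ^ K) := by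
          rw [hR, mul_pow]; field_simp
      _ ≤ K.factorial * C / κ ^ K * (2 * |s.im| ^ (1 / 2 : ℝ)) := by
          rw [e]
          gcongr
          exact rpow_le_two_mul_rpow hT.le le_rfl (by norm_num) (by norm_num)
      _ = _ := by ring
  · refine DifferentiableOn.diffContOnCl fun z hz ↦ ?_
    obtain ⟨h1, h2, h3, -⟩ := hball z (Metric.closure_ball_subset_closedBall hz)
    exact (differentiableAt_negLogDerivZetaSubZeta (h z h1 h2 h3).1).differentiableWithinAt
  · obtain ⟨h1, h2, h3, h4⟩ := hball z (Metric.sphere_subset_closedBall hz)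
    refine (h z h1 h2 h3).2.trans ?_
    gcongr

theorem continuousOn_iteratedDeriv_negLogDerivZetaSubZeta (K : ℕ) :
    ContinuousOn (iteratedDeriv K negLogDerivZetaSubZeta) {s | 1 ≤ s.re} := by
  have hU : IsOpen {s : ℂ | riemannZeta₁ s ≠ 0} :=
    isOpen_ne_fun differentiable_riemannZeta₁.continuous continuous_const
  have hd : DifferentiableOn ℂ negLogDerivZetaSubZeta {s : ℂ | riemannZeta₁ s ≠ 0} :=
    fun s hs ↦ (differentiableAt_negLogDerivZetaSubZeta hs).differentiableWithinAt
  have := (hd.analyticOnNhd hU).iterated_deriv K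
  rw [iteratedDeriv_eq_iterate]
  exact this.continuousOn.mono fun s hs ↦ riemannZeta₁_ne_zero_of_one_le_re hs

theorem exists_norm_iteratedDeriv_negLogDerivZetaSubZeta_le (K : ℕ) :
    ∃ C : ℝ, 0 < C ∧ ∀ s : ℂ, 1 < s.re → s.re ≤ 2 →
      ‖iteratedDeriv K negLogDerivZetaSubZeta s‖ ≤ C * (1 + |s.im|) ^ (1 / 2 : ℝ) := by
  obtain ⟨C₁, hC₁, h₁⟩ := exists_norm_iteratedDeriv_negLogDerivZetaSubZeta_le_of_three_le K
  obtain ⟨C₂, h₂⟩ := ((isCompact_Icc (a := (1 : ℝ)) (b := 2)).reProdIm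
    (isCompact_Icc (a := (-3 : ℝ)) (b := 3))).exists_bound_of_continuousOn
    ((continuousOn_iteratedDeriv_negLogDerivZetaSubZeta K).mono fun s hs ↦ hs.1.1)
  refine ⟨max C₁ C₂, lt_max_of_lt_left hC₁, fun s hs hs2 ↦ ?_⟩
  have h0 : 0 < max C₁ C₂ := lt_max_of_lt_left hC₁
  rcases le_or_gt 3 |s.im| with ht | ht
  · refine (h₁ s hs hs2 ht).trans ?_
    gcongr
    · exact le_max_left _ _
    · linarith
  · refine (h₂ s ⟨⟨hs.le, hs2⟩, abs_le.1 ht.le⟩).trans ((le_max_right C₁ C₂).trans ?_)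
    exact le_mul_of_one_le_right h0.le
      (Real.one_le_rpow (by linarith [abs_nonneg s.im]) (by norm_num))

theorem one_add_abs_sq_le_two_mul_norm_mul {σ : ℝ} (hσ : 1 ≤ σ) (t : ℝ) :
    (1 + |t|) ^ 2 ≤ 2 * ‖((σ + t * I : ℂ)) * (σ + t * I + 1)‖ := by
  have h1 : 1 + t ^ 2 ≤ ‖(σ + t * I : ℂ)‖ ^ 2 := by
    rw [← normSq_eq_norm_sq, normSq_add_mul_I]; nlinarith
  have h2 : ‖(σ + t * I : ℂ)‖ ≤ ‖(σ + t * I + 1 : ℂ)‖ := by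
    rw [show (σ + t * I + 1 : ℂ) = ((σ + 1 : ℝ) : ℂ) + t * I by push_cast; ring,
      norm_add_mul_I, norm_add_mul_I]
    exact Real.sqrt_le_sqrt (by nlinarith)
  rw [norm_mul]
  have h3 := mul_le_mul_of_nonneg_left h2 (norm_nonneg (σ + t * I : ℂ))
  nlinarith [sq_nonneg (1 - |t|), sq_abs t]

theorem norm_one_div_sub_one_div_le {σ : ℝ} (hσ : 1 ≤ σ) (t : ℝ) :
    ‖(1 / (σ + t * I : ℂ) - 1 / (σ + t * I + 1 : ℂ))‖ ≤ 2 * (1 + |t|) ^ (-2 : ℝ) := by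
  have h0 : (σ + t * I : ℂ) ≠ 0 := by
    intro h; have := congrArg re h; simp at this; linarith
  have h1 : (σ + t * I + 1 : ℂ) ≠ 0 := by
    intro h; have := congrArg re h; simp at this; linarith
  have hp : 0 < 1 + |t| := by positivity
  rw [div_sub_div _ _ h0 h1, show (1 * (σ + t * I + 1) - (σ + t * I) * 1 : ℂ) = 1 by ring, norm_div,
    norm_one, Real.rpow_neg hp.le, Real.rpow_two, ← div_eq_mul_inv,
    div_le_div_iff₀ (norm_pos_iff.mpr (mul_ne_zero h0 h1)) (by positivity), one_mul]
  exact one_add_abs_sq_le_two_mul_norm_mul hσ t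

theorem integrable_one_add_abs_rpow {r : ℝ} (hr : 1 < r) :
    Integrable fun t : ℝ ↦ (1 + |t|) ^ (-r) :=
  integrable_one_add_norm (E := ℝ) (by simpa using hr)

theorem integrable_one_div_sub_one_div {σ : ℝ} (hσ : 1 ≤ σ) :
    Integrable fun t : ℝ ↦ (1 / (σ + t * I : ℂ) - 1 / (σ + t * I + 1 : ℂ)) := by
  refine ((integrable_one_add_abs_rpow one_lt_two).const_mul 2).mono' ?_
    (ae_of_all _ fun t ↦ norm_one_div_sub_one_div_le hσ t)
  refine Measurable.aestronglyMeasurable ?_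
  fun_prop

theorem hasMellin_max_one_sub {s : ℂ} (hs : 0 < s.re) :
    HasMellin (fun u : ℝ ↦ ((max 0 (1 - u) : ℝ) : ℂ)) s (1 / s - 1 / (s + 1)) := by
  have h := hasMellin_sub (hasMellin_one_Ioc hs).1
    (hasMellin_cpow_Ioc 1 (s := s) (by simp; linarith)).1
  rw [(hasMellin_one_Ioc hs).2, (hasMellin_cpow_Ioc 1 (s := s) (by simp; linarith)).2] at h
  have key : ∀ u ∈ Ioi (0 : ℝ), (indicator (Ioc 0 1) (fun _ => 1 : ℝ → ℂ) u -
      indicator (Ioc 0 1) (fun t : ℝ => (t : ℂ) ^ (1 : ℂ)) u) = ((max 0 (1 - u) : ℝ) : ℂ) := by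
    intro u hu
    by_cases h1 : u ≤ 1
    · rw [indicator_of_mem (show u ∈ Ioc (0 : ℝ) 1 from ⟨hu, h1⟩),
        indicator_of_mem (show u ∈ Ioc (0 : ℝ) 1 from ⟨hu, h1⟩), max_eq_right (by linarith)]
      simp
    · rw [indicator_of_notMem (fun h ↦ h1 h.2), indicator_of_notMem (fun h ↦ h1 h.2),
        max_eq_left (by linarith)]
      simp
  refine ⟨IntegrableOn.congr_fun h.1 (fun u hu ↦ ?_) measurableSet_Ioi, ?_⟩
  · simp only [key u hu]
  · rw [← h.2]
    refine setIntegral_congr_fun measurableSet_Ioi fun u hu ↦ ?_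
    simp only [key u hu]

theorem integral_cpow_mul_one_div_sub {σ : ℝ} (hσ : 1 ≤ σ) {y : ℝ} (hy : 0 < y) :
    ∫ t : ℝ, (y : ℂ) ^ (-(σ + t * I : ℂ)) * (1 / (σ + t * I : ℂ) - 1 / (σ + t * I + 1 : ℂ)) =
      2 * Real.pi * ((max 0 (1 - y) : ℝ) : ℂ) := by
  have hm : ∀ t : ℝ, mellin (fun u : ℝ ↦ ((max 0 (1 - u) : ℝ) : ℂ)) (σ + t * I) =
      1 / (σ + t * I : ℂ) - 1 / (σ + t * I + 1 : ℂ) := fun t ↦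
    (hasMellin_max_one_sub (by simp; linarith)).2
  have h := mellinInv_mellin_eq σ (fun u : ℝ ↦ ((max 0 (1 - u) : ℝ) : ℂ)) hy
    (hasMellin_max_one_sub (by simp; linarith)).1
    (by simpa only [VerticalIntegrable, hm] using integrable_one_div_sub_one_div hσ)
    (by fun_prop)
  simp only [mellinInv, hm, smul_eq_mul] at h
  rw [← h, Complex.real_smul]
  have : (Real.pi : ℂ) ≠ 0 := by exact_mod_cast Real.pi_ne_zero
  rw [← mul_assoc, show (2 * Real.pi : ℂ) * ((1 / (2 * Real.pi) : ℝ) : ℂ) = 1 by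
    push_cast; field_simp, one_mul]

theorem norm_tsum_mul_max_le {g : ℕ → ℂ} (h0 : g 0 = 0) {σ : ℝ} (hσ : 1 ≤ σ)
    (hg : LSeriesSummable g σ) {x : ℝ} (hx : 0 < x) {C : ℝ}
    (hC : ∀ t : ℝ, ‖LSeries g (σ + t * I)‖ ≤ C * (1 + |t|) ^ (1 / 2 : ℝ)) :
    ‖∑' n, g n * ((max 0 (1 - n / x) : ℝ) : ℂ)‖ ≤
      C * x ^ σ * ∫ t : ℝ, (1 + |t|) ^ (-(3 / 2) : ℝ) := by
  set K : ℝ → ℂ := fun t ↦ 1 / (σ + t * I : ℂ) - 1 / (σ + t * I + 1 : ℂ) with hK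
  have hKi : Integrable K := integrable_one_div_sub_one_div hσ
  have hxs : ∀ t : ℝ, ‖(x : ℂ) ^ (σ + t * I : ℂ)‖ = x ^ σ := fun t ↦ by
    rw [norm_cpow_eq_rpow_re_of_pos hx]; simp
  have hxm : Measurable fun t : ℝ ↦ (x : ℂ) ^ (σ + t * I : ℂ) := by
    have : (x : ℂ) ≠ 0 := by exact_mod_cast hx.ne'
    refine Continuous.measurable ?_
    exact Continuous.const_cpow (by fun_prop) (Or.inl this)
  set F : ℕ → ℝ → ℂ := fun n t ↦ LSeries.term g (σ + t * I) n * (x : ℂ) ^ (σ + t * I : ℂ) * K t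
    with hF
  have hFn : ∀ n t, ‖F n t‖ = ‖LSeries.term g σ n‖ * x ^ σ * ‖K t‖ := fun n t ↦ by
    simp only [hF, norm_mul, hxs, LSeries.norm_term_eq]
    simp
  have htm : ∀ n, Measurable fun t : ℝ ↦ LSeries.term g (σ + t * I) n := fun n ↦ by
    rcases eq_or_ne n 0 with rfl | hn
    · simp
    simp only [LSeries.term_of_ne_zero hn]
    have : (n : ℂ) ≠ 0 := by exact_mod_cast hn
    refine Measurable.const_div (Continuous.measurable ?_) _
    exact Continuous.const_cpow (by fun_prop) (Or.inl this)
  have hFi : ∀ n, Integrable (F n) := fun n ↦ by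
    refine (hKi.norm.const_mul (‖LSeries.term g σ n‖ * x ^ σ)).mono' ?_
      (ae_of_all _ fun t ↦ (hFn n t).le)
    exact (((htm n).mul hxm).aestronglyMeasurable).mul hKi.aestronglyMeasurable
  have hsum : Summable fun n ↦ ∫ t, ‖F n t‖ := by
    simp only [hFn, integral_const_mul]
    exact ((hg.norm.mul_right (x ^ σ)).mul_right _)
  have hS := hasSum_integral_of_summable_integral_norm hFi hsum
  have hFint : ∀ n, ∫ t, F n t = 2 * Real.pi * (g n * ((max 0 (1 - n / x) : ℝ) : ℂ)) := fun n ↦ by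
    rcases eq_or_ne n 0 with rfl | hn
    · simp [hF, h0]
    have hn' : (0 : ℝ) < n := by positivity
    have hr : ∀ t, F n t = g n * (((n / x : ℝ) : ℂ) ^ (-(σ + t * I : ℂ)) * K t) := fun t ↦ by
      simp only [hF, LSeries.term_of_ne_zero hn]
      rw [ofReal_div, ofReal_natCast, div_eq_mul_inv (n : ℂ), ← ofReal_natCast, ← ofReal_inv,
        mul_cpow_ofReal_nonneg hn'.le (by positivity), ofReal_inv, inv_cpow _ _ (by
          rw [arg_ofReal_of_nonneg hx.le]; exact Real.pi_pos.ne), cpow_neg, cpow_neg, inv_inv]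
      ring
    simp only [hr, integral_const_mul]
    rw [integral_cpow_mul_one_div_sub hσ (by positivity)]
    ring
  have hts : ∀ t, ∑' n, F n t = LSeries g (σ + t * I) * (x : ℂ) ^ (σ + t * I : ℂ) * K t := by
    intro t
    simp only [hF, LSeries, tsum_mul_right]
  simp only [hFint, hts] at hS
  have h2 := hS.tsum_eq
  rw [tsum_mul_left] at h2
  have hb : ‖∫ t : ℝ, LSeries g (σ + t * I) * (x : ℂ) ^ (σ + t * I : ℂ) * K t‖ ≤
      ∫ t : ℝ, 2 * C * x ^ σ * (1 + |t|) ^ (-(3 / 2) : ℝ) := by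
    refine norm_integral_le_of_norm_le
      ((integrable_one_add_abs_rpow (r := 3 / 2) (by norm_num)).const_mul _)
      (ae_of_all _ fun t ↦ ?_)
    rw [norm_mul, norm_mul, hxs]
    have hp : 0 < 1 + |t| := by positivity
    calc _ ≤ C * (1 + |t|) ^ (1 / 2 : ℝ) * x ^ σ * (2 * (1 + |t|) ^ (-2 : ℝ)) := by
          gcongr
          · exact mul_nonneg ((norm_nonneg _).trans (hC t)) (by positivity)
          · exact hC t
          · exact norm_one_div_sub_one_div_le hσ t
      _ = 2 * C * x ^ σ * ((1 + |t|) ^ (1 / 2 : ℝ) * (1 + |t|) ^ (-2 : ℝ)) := by ring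
      _ = _ := by rw [← Real.rpow_add hp]; norm_num
  rw [integral_const_mul, ← h2, norm_mul] at hb
  have h3 : ‖(2 * Real.pi : ℂ)‖ = 2 * Real.pi := by
    rw [norm_mul, norm_real, Real.norm_of_nonneg Real.pi_pos.le]; norm_num
  rw [h3] at hb
  have := Real.pi_gt_three
  have h4 := norm_nonneg (∑' n, g n * ((max 0 (1 - n / x) : ℝ) : ℂ))
  nlinarith

theorem logMul_iterate_apply (f : ℕ → ℂ) (K n : ℕ) :
    (LSeries.logMul^[K] f) n = (Real.log n : ℂ) ^ K * f n := by
  induction K with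
  | zero => simp
  | succ K ih =>
    rw [Function.iterate_succ_apply', LSeries.logMul, ih, ← natCast_log]
    ring

theorem LSeries_vonMangoldt_sub_one {s : ℂ} (hs : 1 < s.re) :
    LSeries (fun n ↦ (ArithmeticFunction.vonMangoldt n : ℂ) - 1) s = negLogDerivZetaSubZeta s := by
  have hs1 : s ≠ 1 := by rintro rfl; simp at hs
  have h := LSeries_sub (ArithmeticFunction.LSeriesSummable_vonMangoldt hs)
    (LSeriesSummable_one_iff.mpr hs)
  rw [ArithmeticFunction.LSeries_vonMangoldt_eq_deriv_riemannZeta_div hs,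
    LSeries_one_eq_riemannZeta hs] at h
  rw [negLogDerivZetaSubZeta_eq hs1 (riemannZeta_ne_zero_of_one_lt_re hs), ← h]
  rfl

theorem abscissaOfAbsConv_vonMangoldt_sub_one_le :
    LSeries.abscissaOfAbsConv (fun n ↦ (ArithmeticFunction.vonMangoldt n : ℂ) - 1) ≤ 1 := by
  refine LSeries.abscissaOfAbsConv_le_of_forall_lt_LSeriesSummable fun y hy ↦ ?_
  have hs : 1 < (y : ℂ).re := by simpa using hy
  exact (ArithmeticFunction.LSeriesSummable_vonMangoldt hs).sub (LSeriesSummable_one_iff.mpr hs)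

theorem norm_LSeries_logMul_iterate_vonMangoldt_sub_one (K : ℕ) {s : ℂ} (hs : 1 < s.re) :
    ‖LSeries (LSeries.logMul^[K] fun n ↦ (ArithmeticFunction.vonMangoldt n : ℂ) - 1) s‖ =
      ‖iteratedDeriv K negLogDerivZetaSubZeta s‖ := by
  have h := LSeries_iteratedDeriv (f := fun n ↦ (ArithmeticFunction.vonMangoldt n : ℂ) - 1) K
    (s := s) (abscissaOfAbsConv_vonMangoldt_sub_one_le.trans_lt (by exact_mod_cast hs))
  have hev : LSeries (fun n ↦ (ArithmeticFunction.vonMangoldt n : ℂ) - 1) =ᶠ[nhds s]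
      negLogDerivZetaSubZeta := by
    filter_upwards [(isOpen_lt continuous_const continuous_re).mem_nhds hs] with z hz
    exact LSeries_vonMangoldt_sub_one hz
  rw [← hev.iteratedDeriv_eq, h]
  simp

theorem exists_abs_tsum_vonMangoldt_sub_one_le {K : ℕ} (hK : K ≠ 0) :
    ∃ C, 0 < C ∧ ∀ x : ℝ, Real.exp 1 ≤ x →
      |∑' n : ℕ, Real.log n ^ K * (ArithmeticFunction.vonMangoldt n - 1) * max 0 (1 - n / x)| ≤
        C * x := by
  obtain ⟨C, hC, hCb⟩ := exists_norm_iteratedDeriv_negLogDerivZetaSubZeta_le K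
  set A := ∫ t : ℝ, (1 + |t|) ^ (-(3 / 2) : ℝ) with hA
  have hA0 : 0 ≤ A := integral_nonneg fun t ↦ by positivity
  refine ⟨C * Real.exp 1 * (A + 1), by positivity, fun x hx ↦ ?_⟩
  have hx0 : 0 < x := (Real.exp_pos 1).trans_le hx
  have hlog : 1 ≤ Real.log x := by rwa [Real.le_log_iff_exp_le hx0]
  have hσ1 : 1 < 1 + 1 / Real.log x := by
    have : 0 < 1 / Real.log x := by positivity
    linarith
  have hσ2 : 1 + 1 / Real.log x ≤ 2 := by
    have : 1 / Real.log x ≤ 1 := by rw [div_le_one (by linarith)]; exact hlog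
    linarith
  set g : ℕ → ℂ := LSeries.logMul^[K] fun n ↦ (ArithmeticFunction.vonMangoldt n : ℂ) - 1 with hg
  have hgn : ∀ n, g n = (Real.log n : ℂ) ^ K * ((ArithmeticFunction.vonMangoldt n : ℂ) - 1) :=
    logMul_iterate_apply _ K
  have h := norm_tsum_mul_max_le (g := g) (by simp [hgn, hK]) hσ1.le
    (LSeriesSummable_of_abscissaOfAbsConv_lt_re (by
      rw [hg, LSeries.absicssaOfAbsConv_logPowMul]
      refine abscissaOfAbsConv_vonMangoldt_sub_one_le.trans_lt ?_
      rw [ofReal_re]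
      exact_mod_cast hσ1)) hx0 (C := C) (fun t ↦ by
      rw [hg, norm_LSeries_logMul_iterate_vonMangoldt_sub_one K (by simpa using hσ1)]
      simpa using hCb (((1 + 1 / Real.log x : ℝ) : ℂ) + t * I) (by simpa using hσ1)
        (by simpa using hσ2))
  have hpow : x ^ (1 + 1 / Real.log x) = Real.exp 1 * x := by
    rw [Real.rpow_add hx0, Real.rpow_one, Real.rpow_def_of_pos hx0,
      mul_one_div_cancel (by linarith), mul_comm]
  rw [hpow] at h
  have he : (∑' n, g n * ((max 0 (1 - n / x) : ℝ) : ℂ)) =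
      ((∑' n : ℕ, Real.log n ^ K * (ArithmeticFunction.vonMangoldt n - 1) *
        max 0 (1 - n / x) : ℝ) : ℂ) := by
    rw [ofReal_tsum]
    refine tsum_congr fun n ↦ ?_
    rw [hgn]
    push_cast
    ring
  rw [he, norm_real, Real.norm_eq_abs] at h
  refine h.trans ?_
  have : 0 ≤ C * Real.exp 1 * x := by positivity
  nlinarith

theorem sum_sub_le_smoothed_and_smoothed_le_sum_add (g : ℕ → ℝ) {x h D : ℝ} (hx : 0 ≤ x)
    (hh : 0 < h) (hD : 0 ≤ D) (hg : ∀ n : ℕ, (n : ℝ) ≤ x + h → -D ≤ g n) :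
    h * ((∑ n ∈ Finset.range (⌊x⌋₊ + 1), g n) - D * (h + 1)) ≤
      (∑ n ∈ Finset.range (⌊x + h⌋₊ + 1), g n * (x + h - n)) -
        ∑ n ∈ Finset.range (⌊x⌋₊ + 1), g n * (x - n) ∧
    (∑ n ∈ Finset.range (⌊x + h⌋₊ + 1), g n * (x + h - n)) -
        ∑ n ∈ Finset.range (⌊x⌋₊ + 1), g n * (x - n) ≤
      h * ((∑ n ∈ Finset.range (⌊x + h⌋₊ + 1), g n) + D * (h + 1)) := by
  have hle : ⌊x⌋₊ + 1 ≤ ⌊x + h⌋₊ + 1 := by gcongr; linarith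
  have hIco : ∀ n ∈ Finset.Ico (⌊x⌋₊ + 1) (⌊x + h⌋₊ + 1), x < n ∧ (n : ℝ) ≤ x + h := fun n hn ↦ by
    rw [Finset.mem_Ico] at hn
    exact ⟨(Nat.lt_iff_add_one_le.mpr hn.1 |> Nat.lt_of_floor_lt),
      (Nat.le_floor_iff (by linarith)).mp (Nat.lt_succ_iff.mp hn.2)⟩
  have hcard : ((Finset.Ico (⌊x⌋₊ + 1) (⌊x + h⌋₊ + 1)).card : ℝ) ≤ h + 1 := by
    rw [Nat.card_Ico, Nat.cast_sub hle]
    push_cast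
    have := Nat.floor_le (show 0 ≤ x + h by linarith)
    have := Nat.lt_floor_add_one x
    linarith
  have e1 := Finset.sum_Ico_eq_sub (fun n ↦ g n * (x + h - n)) hle
  have e2 := Finset.sum_Ico_eq_sub g hle
  have e3 : ∑ n ∈ Finset.range (⌊x⌋₊ + 1), g n * (x + h - n) =
      ∑ n ∈ Finset.range (⌊x⌋₊ + 1), g n * (x - n) + h * ∑ n ∈ Finset.range (⌊x⌋₊ + 1), g n := by
    rw [Finset.mul_sum, ← Finset.sum_add_distrib]
    exact Finset.sum_congr rfl fun n _ ↦ by ring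
  have hDc := mul_le_mul_of_nonneg_left hcard (mul_nonneg hD hh.le)
  have b1 : -(D * h * (h + 1)) ≤
      ∑ n ∈ Finset.Ico (⌊x⌋₊ + 1) (⌊x + h⌋₊ + 1), g n * (x + h - n) := by
    have : ∀ n ∈ Finset.Ico (⌊x⌋₊ + 1) (⌊x + h⌋₊ + 1), -(D * h) ≤ g n * (x + h - n) :=
      fun n hn ↦ by
        obtain ⟨h1, h2⟩ := hIco n hn
        have := hg n h2
        nlinarith
    have := Finset.card_nsmul_le_sum _ _ _ this
    rw [nsmul_eq_mul] at this
    linarith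
  have b2 : -(D * h * (h + 1)) ≤
      ∑ n ∈ Finset.Ico (⌊x⌋₊ + 1) (⌊x + h⌋₊ + 1), (h * g n - g n * (x + h - n)) := by
    have : ∀ n ∈ Finset.Ico (⌊x⌋₊ + 1) (⌊x + h⌋₊ + 1),
        -(D * h) ≤ h * g n - g n * (x + h - n) :=
      fun n hn ↦ by
        obtain ⟨h1, h2⟩ := hIco n hn
        have := hg n h2
        nlinarith
    have := Finset.card_nsmul_le_sum _ _ _ this
    rw [nsmul_eq_mul] at this
    linarith
  rw [Finset.sum_sub_distrib, ← Finset.mul_sum] at b2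
  constructor
  · nlinarith
  · rw [e2] at b2
    nlinarith

theorem exists_abs_smoothed_sum_vonMangoldt_sub_one_le {K : ℕ} (hK : K ≠ 0) :
    ∃ C, 0 < C ∧ ∀ x : ℝ, Real.exp 1 ≤ x →
      |∑ n ∈ Finset.range (⌊x⌋₊ + 1),
        Real.log n ^ K * (ArithmeticFunction.vonMangoldt n - 1) * (x - n)| ≤ C * x ^ 2 := by
  obtain ⟨C, hC, h⟩ := exists_abs_tsum_vonMangoldt_sub_one_le hK
  refine ⟨C, hC, fun x hx ↦ ?_⟩
  have hx0 : 0 < x := (Real.exp_pos 1).trans_le hx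
  have hx' := h x hx
  rw [tsum_eq_sum (s := Finset.range (⌊x⌋₊ + 1)) (fun n hn ↦ by
    rw [Finset.mem_range, not_lt] at hn
    have : x < n := Nat.lt_of_floor_lt hn
    rw [max_eq_left (by rw [sub_nonpos, one_le_div hx0]; exact this.le), mul_zero])] at hx'
  have e : ∑ n ∈ Finset.range (⌊x⌋₊ + 1),
        Real.log n ^ K * (ArithmeticFunction.vonMangoldt n - 1) * (x - n) =
      x * ∑ n ∈ Finset.range (⌊x⌋₊ + 1),
        Real.log n ^ K * (ArithmeticFunction.vonMangoldt n - 1) * max 0 (1 - n / x) := by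
    rw [Finset.mul_sum]
    refine Finset.sum_congr rfl fun n hn ↦ ?_
    have : (n : ℝ) ≤ x := (Nat.le_floor_iff hx0.le).mp (Nat.lt_succ_iff.mp (Finset.mem_range.mp hn))
    rw [max_eq_right (by rw [sub_nonneg, div_le_one hx0]; exact this)]
    field_simp
  rw [e, abs_mul, abs_of_pos hx0]
  nlinarith

theorem exists_abs_sum_log_pow_mul_vonMangoldt_sub_one_le {J : ℕ} (hJ : J ≠ 0) :
    ∃ C, 0 < C ∧ ∀ᶠ x : ℝ in atTop,
      |∑ n ∈ Finset.range (⌊x⌋₊ + 1),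
        Real.log n ^ (2 * J) * (ArithmeticFunction.vonMangoldt n - 1)| ≤ C * x * Real.log x ^ J := by
  obtain ⟨C, hC, hT⟩ := exists_abs_smoothed_sum_vonMangoldt_sub_one_le (K := 2 * J) (by omega)
  refine ⟨8 * C + 2 ^ (2 * J) * 2, by positivity, ?_⟩
  have hlogJ : ∀ᶠ x : ℝ in atTop, Real.log x ^ J ≤ x := by
    have := (Real.isLittleO_pow_log_id_atTop (n := J)).bound (c := 1) one_pos
    filter_upwards [this, eventually_ge_atTop 1] with x h1 h2
    have h3 := Real.log_nonneg h2
    simp only [id, one_mul, Real.norm_eq_abs] at h1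
    rwa [abs_of_nonneg (by positivity), abs_of_nonneg (by linarith)] at h1
  filter_upwards [hlogJ, eventually_ge_atTop (2 * Real.exp 1), eventually_ge_atTop (Real.exp 2)]
    with x hxJ hx hx2
  have hx0 : 0 < x := (Real.exp_pos 2).trans_le hx2
  have hxe : Real.exp 1 ≤ x := by linarith [Real.exp_pos 1]
  have hL : 2 ≤ Real.log x := by rwa [Real.le_log_iff_exp_le hx0]
  set L := Real.log x with hLdef
  have hLJ : 2 ≤ L ^ J := hL.trans (le_self_pow₀ (by linarith) hJ)
  set h := x / L ^ J with hh
  have hLJ0 : 0 < L ^ J := by linarith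
  have hhL : h * L ^ J = x := by rw [hh]; field_simp
  have hh0 : 1 ≤ h := by rw [hh, one_le_div hLJ0]; exact hxJ
  have hhx : 2 * h ≤ x := by nlinarith
  set D := (2 * L) ^ (2 * J) with hD
  have hD0 : 0 ≤ D := by positivity
  set g : ℕ → ℝ := fun n ↦ Real.log n ^ (2 * J) * (ArithmeticFunction.vonMangoldt n - 1) with hg
  have hgD : ∀ n : ℕ, (n : ℝ) ≤ 2 * x → -D ≤ g n := fun n hn ↦ by
    have h1 : Real.log n ≤ 2 * L := by
      rcases Nat.eq_zero_or_pos n with rfl | hn0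
      · simp; linarith
      calc Real.log n ≤ Real.log (2 * x) := Real.log_le_log (by positivity) hn
        _ = Real.log 2 + L := Real.log_mul two_ne_zero hx0.ne'
        _ ≤ _ := by linarith [Real.log_two_lt_d9]
    have h2 : Real.log n ^ (2 * J) ≤ D := pow_le_pow_left₀ (Real.log_natCast_nonneg n) h1 _
    have h3 : 0 ≤ Real.log n ^ (2 * J) := pow_nonneg (Real.log_natCast_nonneg n) _
    have h4 : 0 ≤ ArithmeticFunction.vonMangoldt n := ArithmeticFunction.vonMangoldt_nonneg
    simp only [hg]
    nlinarith
  have hup := (sum_sub_le_smoothed_and_smoothed_le_sum_add g hx0.le (by linarith : 0 < h) hD0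
    (fun n hn ↦ hgD n (by linarith))).1
  have hlow := (sum_sub_le_smoothed_and_smoothed_le_sum_add g (by linarith : 0 ≤ x - h)
    (by linarith : 0 < h) hD0 (fun n hn ↦ hgD n (by linarith))).2
  rw [sub_add_cancel] at hlow
  have t1 := abs_le.mp (hT x hxe)
  have t2 := abs_le.mp (hT (x + h) (by linarith))
  have t3 := abs_le.mp (hT (x - h) (by linarith))
  have q2 : (x + h) ^ 2 ≤ 3 * x ^ 2 := by nlinarith
  have q3 : (x - h) ^ 2 ≤ x ^ 2 := by nlinarith
  have hDh : D * (h + 1) ≤ 2 ^ (2 * J) * 2 * x * L ^ J := by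
    calc D * (h + 1) ≤ D * (2 * h) := by gcongr; linarith
      _ = 2 ^ (2 * J) * 2 * (h * L ^ J) * L ^ J := by rw [hD, mul_pow, pow_mul L 2 J]; ring
      _ = _ := by rw [hhL]
  have hx2h : x ^ 2 = h * (x * L ^ J) := by rw [← hhL]; ring
  rw [abs_le]
  have hcq2 := mul_le_mul_of_nonneg_left q2 hC.le
  have hcq3 := mul_le_mul_of_nonneg_left q3 hC.le
  have hcx : C * x ^ 2 = h * (C * x * L ^ J) := by rw [hx2h]; ring
  have hp : 0 ≤ C * x * L ^ J := by positivity
  constructor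
  · have : h * -(2 * (C * x * L ^ J)) ≤
        h * ((∑ n ∈ Finset.range (⌊x⌋₊ + 1), g n) + D * (h + 1)) := by
      linarith [t1.1, t3.2]
    have := le_of_mul_le_mul_left this (by linarith)
    linarith
  · have : h * ((∑ n ∈ Finset.range (⌊x⌋₊ + 1), g n) - D * (h + 1)) ≤
        h * (4 * (C * x * L ^ J)) := by
      linarith [t1.1, t2.2]
    have := le_of_mul_le_mul_left this (by linarith)
    linarith

theorem abs_sum_Ioc_mul_le_of_antitone {w g : ℕ → ℝ} {a b : ℕ} (hab : a ≤ b) {M : ℝ}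
    (hw : ∀ n, a ≤ n → w (n + 1) ≤ w n) (hw0 : ∀ n, a ≤ n → 0 ≤ w n)
    (hM : ∀ n, a ≤ n → n ≤ b → |∑ k ∈ Finset.range (n + 1), g k| ≤ M) :
    |∑ n ∈ Finset.Ioc a b, w n * g n| ≤ 2 * M * w a := by
  have key : |(∑ n ∈ Finset.Ioc a b, w n * g n) - w b * ∑ k ∈ Finset.range (b + 1), g k| ≤
      M * (2 * w a - w b) := by
    induction b, hab using Nat.le_induction with
    | base =>
      have h := hM a le_rfl le_rfl
      have h0 := hw0 a le_rfl
      rw [Finset.Ioc_self, Finset.sum_empty, zero_sub, abs_neg, abs_mul, abs_of_nonneg h0]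
      nlinarith
    | succ b hb ih =>
      have ih := ih fun n h1 h2 ↦ hM n h1 (by omega)
      have h := hM b hb (by omega)
      have h1 := hw b hb
      have e : (∑ n ∈ Finset.Ioc a (b + 1), w n * g n) -
          w (b + 1) * ∑ k ∈ Finset.range (b + 1 + 1), g k =
          ((∑ n ∈ Finset.Ioc a b, w n * g n) - w b * ∑ k ∈ Finset.range (b + 1), g k) +
            (w b - w (b + 1)) * ∑ k ∈ Finset.range (b + 1), g k := by
        rw [Finset.sum_Ioc_succ_top (by omega), Finset.sum_range_succ]
        ring
      rw [e]
      refine (abs_add_le _ _).trans ?_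
      rw [abs_mul, abs_of_nonneg (sub_nonneg.mpr h1)]
      nlinarith
  have h := hM b hab le_rfl
  have h0 := hw0 b hab
  have h3 : |w b * ∑ k ∈ Finset.range (b + 1), g k| ≤ M * w b := by
    rw [abs_mul, abs_of_nonneg h0]
    nlinarith
  have := abs_sub_abs_le_abs_sub (∑ n ∈ Finset.Ioc a b, w n * g n)
    (w b * ∑ k ∈ Finset.range (b + 1), g k)
  linarith

theorem exists_abs_sum_Ioc_vonMangoldt_sub_one_div_log_le {s t : ℝ} (hst : s < t) {J : ℕ}
    (hJ : J ≠ 0) :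
    ∃ C, ∀ᶠ x : ℝ in atTop,
      |∑ n ∈ Finset.Ioc ⌊Real.exp (x - t)⌋₊ ⌊Real.exp (x - s)⌋₊,
        (ArithmeticFunction.vonMangoldt n - 1) / Real.log n| ≤ C * (Real.exp x / x ^ (J + 1)) := by
  obtain ⟨C, hC, hS⟩ := exists_abs_sum_log_pow_mul_vonMangoldt_sub_one_le hJ
  obtain ⟨x₀, hx₀⟩ := eventually_atTop.mp hS
  have hS' : ∀ n : ℕ, x₀ ≤ n → |∑ k ∈ Finset.range (n + 1),
      Real.log k ^ (2 * J) * (ArithmeticFunction.vonMangoldt k - 1)| ≤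
        C * n * Real.log n ^ J := fun n hn ↦ by
    simpa using hx₀ n hn
  refine ⟨2 * C * Real.exp (-s) * 2 ^ J * 2 ^ (2 * J + 1), ?_⟩
  have hyt : Tendsto (fun x : ℝ ↦ Real.exp (x - t)) atTop atTop :=
    Real.tendsto_exp_atTop.comp (tendsto_atTop_add_const_right _ _ tendsto_id)
  filter_upwards [hyt.eventually_ge_atTop (max (x₀ + 1) 4), eventually_ge_atTop (-s),
    eventually_ge_atTop (2 * (t + 1)), eventually_ge_atTop 1] with x h1 h2 h3 h4
  set y := Real.exp (x - t) with hy
  set z := Real.exp (x - s) with hz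
  have hyx := (le_max_left _ _).trans h1
  have hy4 := (le_max_right _ _).trans h1
  have hyz : y ≤ z := Real.exp_le_exp.mpr (by linarith)
  have hab : ⌊y⌋₊ ≤ ⌊z⌋₊ := Nat.floor_le_floor hyz
  have hya := Nat.sub_one_lt_floor y
  have ha3 : (3 : ℝ) < ⌊y⌋₊ := by linarith
  have hlog : ∀ n : ℕ, ⌊y⌋₊ ≤ n → 0 < Real.log n := fun n hn ↦ by
    have : (⌊y⌋₊ : ℝ) ≤ n := by exact_mod_cast hn
    exact Real.log_pos (by linarith)
  have hzb := Nat.floor_le (show 0 ≤ z by positivity)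
  have hA := abs_sum_Ioc_mul_le_of_antitone (w := fun n ↦ 1 / Real.log n ^ (2 * J + 1))
    (g := fun k ↦ Real.log k ^ (2 * J) * (ArithmeticFunction.vonMangoldt k - 1))
    (M := C * z * Real.log z ^ J) hab (fun n hn ↦ by
      have h0 := hlog n hn
      have : (⌊y⌋₊ : ℝ) ≤ n := by exact_mod_cast hn
      have h1 : Real.log n ≤ Real.log ((n + 1 : ℕ) : ℝ) :=
        Real.log_le_log (by linarith) (by push_cast; linarith)
      gcongr) (fun n hn ↦ by
      have h0 := hlog n hn
      positivity) (fun n hn hn' ↦ by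
      have e1 : (⌊y⌋₊ : ℝ) ≤ n := by exact_mod_cast hn
      have e2 : (n : ℝ) ≤ z := le_trans (by exact_mod_cast hn') hzb
      have h0 := hlog n hn
      refine (hS' n (by linarith)).trans ?_
      have : Real.log n ≤ Real.log z := Real.log_le_log (by linarith) e2
      gcongr)
  have e : ∑ n ∈ Finset.Ioc ⌊y⌋₊ ⌊z⌋₊, 1 / Real.log n ^ (2 * J + 1) *
      (Real.log n ^ (2 * J) * (ArithmeticFunction.vonMangoldt n - 1)) =
      ∑ n ∈ Finset.Ioc ⌊y⌋₊ ⌊z⌋₊, (ArithmeticFunction.vonMangoldt n - 1) / Real.log n := by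
    refine Finset.sum_congr rfl fun n hn ↦ ?_
    have := hlog n (Finset.mem_Ioc.mp hn).1.le
    rw [pow_succ]
    field_simp
  rw [e] at hA
  refine hA.trans ?_
  have hlz : Real.log z = x - s := Real.log_exp _
  have hla : x / 2 ≤ Real.log ⌊y⌋₊ := by
    rw [Real.le_log_iff_exp_le (by linarith)]
    calc Real.exp (x / 2) ≤ Real.exp (x - t - 1) := Real.exp_le_exp.mpr (by linarith)
      _ = y / Real.exp 1 := by rw [hy, ← Real.exp_sub]
      _ ≤ y / 2 := by
        have := Real.add_one_le_exp 1
        gcongr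
        linarith
      _ ≤ _ := by linarith
  have hx0 : 0 < x := by linarith
  rw [hlz]
  calc 2 * (C * z * (x - s) ^ J) * (1 / Real.log ⌊y⌋₊ ^ (2 * J + 1))
      ≤ 2 * (C * z * (2 * x) ^ J) * (1 / (x / 2) ^ (2 * J + 1)) := by
        have : 0 ≤ x - s := by linarith
        gcongr
        linarith
    _ = _ := by
      rw [hz, sub_eq_add_neg, Real.exp_add, mul_pow, div_pow]
      field_simp
      ring

theorem abs_sum_Ioc_one_div_log_sub_integral_le {y z : ℝ} (hy : 4 ≤ y) (hyz : y ≤ z) :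
    |(∑ n ∈ Finset.Ioc ⌊y⌋₊ ⌊z⌋₊, 1 / Real.log n) - ∫ u in y..z, 1 / Real.log u| ≤ 1 := by
  set f : ℝ → ℝ := fun u ↦ 1 / Real.log u with hf
  have hlog : ∀ u : ℝ, 3 ≤ u → 1 ≤ Real.log u := fun u hu ↦ by
    rw [Real.le_log_iff_exp_le (by linarith)]
    linarith [Real.exp_one_lt_d9]
  have hf0 : ∀ u : ℝ, 3 ≤ u → 0 ≤ f u := fun u hu ↦ by
    have := hlog u hu; positivity
  have hf1 : ∀ u : ℝ, 3 ≤ u → f u ≤ 1 := fun u hu ↦ by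
    have := hlog u hu
    rw [hf, div_le_one (by linarith)]; exact this
  have hanti : AntitoneOn f (Ici 3) := fun u hu v hv huv ↦ by
    have h1 := hlog u hu
    have : Real.log u ≤ Real.log v := Real.log_le_log (by linarith [mem_Ici.mp hu]) huv
    simp only [hf]
    gcongr
  have hint : ∀ u v : ℝ, 3 ≤ u → 3 ≤ v → IntervalIntegrable f volume u v := fun u v hu hv ↦
    (hanti.mono fun w hw ↦ (le_min hu hv).trans hw.1).intervalIntegrable
  have hsmall : ∀ u v : ℝ, 3 ≤ u → u ≤ v → v ≤ u + 1 →
      0 ≤ ∫ w in u..v, f w ∧ ∫ w in u..v, f w ≤ 1 := fun u v hu huv hv ↦ by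
    refine ⟨intervalIntegral.integral_nonneg huv fun w hw ↦ hf0 w (hu.trans hw.1), ?_⟩
    calc ∫ w in u..v, f w ≤ ∫ w in u..v, (1 : ℝ) :=
          intervalIntegral.integral_mono_on huv (hint u v hu (hu.trans huv))
            intervalIntegrable_const fun w hw ↦ hf1 w (hu.trans hw.1)
      _ ≤ 1 := by simp; linarith
  have hab : ⌊y⌋₊ ≤ ⌊z⌋₊ := Nat.floor_le_floor hyz
  have hya := Nat.sub_one_lt_floor y
  have hya2 := Nat.floor_le (show 0 ≤ y by linarith)
  have hza := Nat.sub_one_lt_floor z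
  have hza2 := Nat.floor_le (show 0 ≤ z by linarith)
  have hab' : (⌊y⌋₊ : ℝ) ≤ ⌊z⌋₊ := by exact_mod_cast hab
  have s1 : ∑ n ∈ Finset.Ioc ⌊y⌋₊ ⌊z⌋₊, 1 / Real.log n =
      ∑ n ∈ Finset.Ico ⌊y⌋₊ ⌊z⌋₊, f ((n + 1 : ℕ) : ℝ) := by
    rw [Finset.sum_Ico_add' (fun n : ℕ ↦ f n)]
    refine Finset.sum_congr ?_ fun n _ ↦ rfl
    ext n
    simp only [Finset.mem_Ioc, Finset.mem_Ico]
    omega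
  have s2 : ∑ n ∈ Finset.Ioc ⌊y⌋₊ ⌊z⌋₊, 1 / Real.log n =
      ∑ n ∈ Finset.Ico (⌊y⌋₊ + 1) (⌊z⌋₊ + 1), f n := by
    refine Finset.sum_congr ?_ fun n _ ↦ rfl
    ext n
    simp only [Finset.mem_Ioc, Finset.mem_Ico]
    omega
  have u1 := AntitoneOn.sum_le_integral_Ico hab (f := f)
    (hanti.mono fun w hw ↦ by rw [mem_Ici]; linarith [hw.1])
  have u2 := AntitoneOn.integral_le_sum_Ico (Nat.add_le_add_right hab 1) (f := f)
    (hanti.mono fun w hw ↦ by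
      have := hw.1
      push_cast at this
      rw [mem_Ici]; linarith)
  rw [← s1] at u1
  rw [← s2] at u2
  push_cast at u2
  have i1 := intervalIntegral.integral_interval_sub_interval_comm'
    (hint ⌊y⌋₊ ⌊z⌋₊ (by linarith) (by linarith)) (hint y z (by linarith) (by linarith))
    (hint ⌊y⌋₊ y (by linarith) (by linarith))
  have i2 := intervalIntegral.integral_interval_sub_interval_comm'
    (hint (⌊y⌋₊ + 1) (⌊z⌋₊ + 1) (by linarith) (by linarith)) (hint y z (by linarith) (by linarith))
    (hint (⌊y⌋₊ + 1) y (by linarith) (by linarith))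
  have j1 := hsmall ⌊y⌋₊ y (by linarith) hya2 (by linarith)
  have j2 := hsmall ⌊z⌋₊ z (by linarith) hza2 (by linarith)
  have j3 := hsmall y (⌊y⌋₊ + 1) (by linarith) (by linarith) (by linarith)
  have j4 := hsmall z (⌊z⌋₊ + 1) (by linarith) (by linarith) (by linarith)
  rw [intervalIntegral.integral_symm ⌊z⌋₊ z, intervalIntegral.integral_symm ⌊y⌋₊ y] at i1
  rw [abs_le]
  constructor <;> linarith

theorem primeCounting_sub_primeCounting {a b : ℕ} (hab : a ≤ b) :
    (Nat.primeCounting b : ℝ) - Nat.primeCounting a =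
      ∑ n ∈ Finset.Ioc a b, if n.Prime then (1 : ℝ) else 0 := by
  induction b, hab using Nat.le_induction with
  | base => simp
  | succ b hb ih =>
    have h : (b + 1).primeCounting = b.primeCounting + if (b + 1).Prime then 1 else 0 :=
      Nat.count_succ _ _
    rw [Finset.sum_Ioc_succ_top (by omega), ← ih, h]
    split_ifs <;> push_cast <;> ring

theorem abs_sum_Ioc_vonMangoldt_div_log_sub_primeCounting_le {y z : ℝ} (hy : 4 ≤ y) (hyz : y ≤ z) :
    |(∑ n ∈ Finset.Ioc ⌊y⌋₊ ⌊z⌋₊, ArithmeticFunction.vonMangoldt n / Real.log n) -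
      ((Nat.primeCounting ⌊z⌋₊ : ℝ) - Nat.primeCounting ⌊y⌋₊)| ≤ 2 * √z * Real.log z := by
  have hab : ⌊y⌋₊ ≤ ⌊z⌋₊ := Nat.floor_le_floor hyz
  have hya := Nat.sub_one_lt_floor y
  have hlog : ∀ n ∈ Finset.Ioc ⌊y⌋₊ ⌊z⌋₊, 1 ≤ Real.log n := fun n hn ↦ by
    have : (⌊y⌋₊ : ℝ) < n := by exact_mod_cast (Finset.mem_Ioc.mp hn).1
    rw [Real.le_log_iff_exp_le (by linarith)]
    linarith [Real.exp_one_lt_d9]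
  have hΛ : ∀ n, 0 ≤ ArithmeticFunction.vonMangoldt n := fun n ↦
    ArithmeticFunction.vonMangoldt_nonneg
  rw [primeCounting_sub_primeCounting hab, ← Finset.sum_sub_distrib]
  have e : ∀ n ∈ Finset.Ioc ⌊y⌋₊ ⌊z⌋₊, ArithmeticFunction.vonMangoldt n / Real.log n -
      (if n.Prime then (1 : ℝ) else 0) =
      if ¬ n.Prime then ArithmeticFunction.vonMangoldt n / Real.log n else 0 := fun n hn ↦ by
    have := hlog n hn
    by_cases hp : n.Prime
    · rw [if_pos hp, if_neg (not_not.mpr hp), ArithmeticFunction.vonMangoldt_apply_prime hp,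
        div_self (by linarith), sub_self]
    · rw [if_neg hp, if_pos hp, sub_zero]
  rw [Finset.sum_congr rfl e, ← Finset.sum_filter, abs_of_nonneg (Finset.sum_nonneg fun n hn ↦ by
    have := hlog n (Finset.mem_filter.mp hn).1
    have := hΛ n
    positivity)]
  refine le_trans ?_ (Chebyshev.psi_sub_theta_le (x := z) (by linarith))
  rw [Chebyshev.psi_sub_theta_eq_sum_not_prime]
  calc _ ≤ ∑ n ∈ Finset.Ioc ⌊y⌋₊ ⌊z⌋₊ with ¬ n.Prime, ArithmeticFunction.vonMangoldt n := by
        refine Finset.sum_le_sum fun n hn ↦ ?_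
        exact div_le_self (hΛ n) (hlog n (Finset.mem_filter.mp hn).1)
    _ ≤ _ := by
      refine Finset.sum_le_sum_of_subset_of_nonneg ?_ fun n _ _ ↦ hΛ n
      gcongr
      exact Nat.zero_le _

theorem one_div_sub_eq_sum_add {x u : ℝ} (hx : x ≠ 0) (hxu : x - u ≠ 0) (N : ℕ) :
    1 / (x - u) = (∑ n ∈ Finset.range N, u ^ n / x ^ (n + 1)) + u ^ N / (x ^ N * (x - u)) := by
  induction N with
  | zero => simp
  | succ N ih =>
    rw [ih, Finset.sum_range_succ]
    field_simp
    ring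

theorem isBigO_integral_exp_neg_div_sub_sub_sum {s t : ℝ} (hst : s < t) (N : ℕ) :
    (fun x : ℝ ↦ (∫ u in s..t, Real.exp (-u) / (x - u)) -
      ∑ n ∈ Finset.range N, (∫ u in s..t, u ^ n * Real.exp (-u)) / x ^ (n + 1))
      =O[atTop] fun x : ℝ ↦ 1 / x ^ (N + 1) := by
  set R := max |s| |t|
  refine Asymptotics.IsBigO.of_bound (Real.exp (-s) * R ^ N * 2 * |t - s|) ?_
  filter_upwards [eventually_ge_atTop (2 * R + 1)] with x hx
  have hR : 0 ≤ R := (abs_nonneg s).trans (le_max_left _ _)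
  have hx0 : 0 < x := by linarith
  have hu : ∀ u ∈ Icc s t, |u| ≤ R := fun u hu ↦ abs_le_max_abs_abs hu.1 hu.2
  have hxu : ∀ u ∈ Icc s t, x / 2 ≤ x - u := fun u h ↦ by
    have := (le_abs_self u).trans (hu u h)
    linarith
  have hc : ContinuousOn (fun u ↦ Real.exp (-u) / (x - u)) (uIcc s t) := by
    refine ContinuousOn.div (by fun_prop) (by fun_prop) fun u h ↦ ?_
    rw [uIcc_of_le hst.le] at h
    have := hxu u h
    linarith
  have hi : ∀ n : ℕ, IntervalIntegrable (fun u : ℝ ↦ u ^ n * Real.exp (-u) / x ^ (n + 1))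
      volume s t := fun n ↦ Continuous.intervalIntegrable (by fun_prop) _ _
  simp only [← intervalIntegral.integral_div]
  rw [← intervalIntegral.integral_finsetSum fun n _ ↦ hi n,
    ← intervalIntegral.integral_sub hc.intervalIntegrable
      (Continuous.intervalIntegrable (by fun_prop) _ _)]
  calc _ ≤ (Real.exp (-s) * R ^ N * 2 * (1 / x ^ (N + 1))) * |t - s| := by
        refine intervalIntegral.norm_integral_le_of_norm_le_const fun u h ↦ ?_
        rw [uIoc_of_le hst.le] at h
        have h' := Ioc_subset_Icc_self h
        have h1 := hxu u h'
        have h2 : 0 < x - u := by linarith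
        have e : Real.exp (-u) / (x - u) -
            ∑ n ∈ Finset.range N, u ^ n * Real.exp (-u) / x ^ (n + 1) =
            Real.exp (-u) * (u ^ N / (x ^ N * (x - u))) := by
          rw [div_eq_mul_one_div, one_div_sub_eq_sum_add hx0.ne' h2.ne' N, mul_add, Finset.mul_sum,
            add_sub_right_comm, ← Finset.sum_sub_distrib, Finset.sum_eq_zero, zero_add]
          intro n _
          ring
        rw [e, norm_mul, norm_div, norm_mul, norm_pow, norm_pow, Real.norm_of_nonneg h2.le,
          Real.norm_of_nonneg hx0.le, Real.norm_of_nonneg (Real.exp_pos _).le, Real.norm_eq_abs]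
        calc _ ≤ Real.exp (-s) * (R ^ N / (x ^ N * (x / 2))) := by
              have := hu u h'
              have := h.1.le
              gcongr
          _ = _ := by rw [pow_succ x N]; field_simp
    _ = _ := by
      rw [Real.norm_of_nonneg (by positivity)]
      ring

theorem exp_neg_mul_integral_one_div_log {s t x : ℝ} (hst : s < t) (hx : t < x) :
    Real.exp (-x) * ∫ v in Real.exp (x - t)..Real.exp (x - s), 1 / Real.log v =
      ∫ u in s..t, Real.exp (-u) / (x - u) := by
  have h := intervalIntegral.integral_comp_mul_deriv' (a := s) (b := t)
    (f := fun u ↦ Real.exp (x - u)) (f' := fun u ↦ -Real.exp (x - u))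
    (g := fun v ↦ 1 / Real.log v) (fun u _ ↦ by
      simpa using ((hasDerivAt_id u).const_sub x).exp) (by fun_prop) (by
      rintro _ ⟨u, hu, rfl⟩
      rw [uIcc_of_le hst.le] at hu
      refine ContinuousAt.continuousWithinAt (ContinuousAt.div continuousAt_const
        (Real.continuousAt_log (Real.exp_pos _).ne') ?_)
      rw [Real.log_exp]
      linarith [hu.2])
  rw [intervalIntegral.integral_symm, ← h, ← intervalIntegral.integral_neg,
    ← intervalIntegral.integral_const_mul]
  refine intervalIntegral.integral_congr fun u _ ↦ ?_
  simp only [Function.comp, Real.log_exp]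
  rw [show Real.exp (-u) = Real.exp (-x) * Real.exp (x - u) by rw [← Real.exp_add]; ring_nf]
  ring

theorem isBigO_exp_neg_mul_primePi_sub_integral {s t : ℝ} (hst : s < t) {J : ℕ} (hJ : J ≠ 0) :
    (fun x : ℝ ↦ Real.exp (-x) * (primePi (Real.exp (x - s)) - primePi (Real.exp (x - t))) -
      ∫ u in s..t, Real.exp (-u) / (x - u)) =O[atTop] fun x : ℝ ↦ 1 / x ^ (J + 1) := by
  obtain ⟨C, hC⟩ := exists_abs_sum_Ioc_vonMangoldt_sub_one_div_log_le hst hJ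
  refine Asymptotics.IsBigO.of_bound (C + 1 + 4 * Real.exp (-s / 2)) ?_
  have hyt : Tendsto (fun x : ℝ ↦ Real.exp (x - t)) atTop atTop :=
    Real.tendsto_exp_atTop.comp (tendsto_atTop_add_const_right _ _ tendsto_id)
  have hpe := (isLittleO_pow_exp_pos_mul_atTop (J + 2) (b := 1 / 2) (by norm_num)).bound one_pos
  filter_upwards [hC, hyt.eventually_ge_atTop 4, hpe, eventually_gt_atTop t, eventually_ge_atTop 1,
    eventually_ge_atTop (-s)] with x h1 h2 h3 h4 h5 h6
  have hx0 : 0 < x := by linarith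
  set y := Real.exp (x - t) with hy
  set z := Real.exp (x - s) with hz
  have hyz : y ≤ z := Real.exp_le_exp.mpr (by linarith)
  have a1 := abs_sum_Ioc_one_div_log_sub_integral_le h2 hyz
  have a2 := abs_sum_Ioc_vonMangoldt_div_log_sub_primeCounting_le h2 hyz
  have hlz : Real.log z = x - s := Real.log_exp _
  have hsz : √z = Real.exp (-s / 2) * Real.exp (x / 2) := by
    rw [hz, ← Real.exp_add, Real.sqrt_eq_iff_mul_self_eq (by positivity) (by positivity),
      ← Real.exp_add]
    ring_nf
  rw [Real.norm_of_nonneg (by positivity), one_mul, Real.norm_of_nonneg (by positivity)] at h3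
  rw [← exp_neg_mul_integral_one_div_log hst h4, ← hy, ← hz, ← mul_sub, norm_mul,
    Real.norm_of_nonneg (Real.exp_pos _).le, Real.norm_eq_abs,
    Real.norm_of_nonneg (by positivity : 0 ≤ 1 / x ^ (J + 1))]
  have key : |primePi z - primePi y - ∫ v in y..z, 1 / Real.log v| ≤
      2 * √z * Real.log z + C * (Real.exp x / x ^ (J + 1)) + 1 := by
    have e : primePi z - primePi y - ∫ v in y..z, 1 / Real.log v =
        -((∑ n ∈ Finset.Ioc ⌊y⌋₊ ⌊z⌋₊, ArithmeticFunction.vonMangoldt n / Real.log n) -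
          ((Nat.primeCounting ⌊z⌋₊ : ℝ) - Nat.primeCounting ⌊y⌋₊)) +
        (∑ n ∈ Finset.Ioc ⌊y⌋₊ ⌊z⌋₊, (ArithmeticFunction.vonMangoldt n - 1) / Real.log n) +
        ((∑ n ∈ Finset.Ioc ⌊y⌋₊ ⌊z⌋₊, 1 / Real.log n) - ∫ v in y..z, 1 / Real.log v) := by
      simp only [sub_div, Finset.sum_sub_distrib, primePi]
      ring
    rw [e]
    refine (abs_add_three _ _ _).trans ?_
    rw [abs_neg]
    gcongr
  have hexp : Real.exp x = Real.exp (x / 2) * Real.exp (x / 2) := by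
    rw [← Real.exp_add]; ring_nf
  have hE : x ^ (J + 2) ≤ Real.exp (x / 2) := by convert h3 using 2; ring
  have hE1 : 1 ≤ Real.exp (x / 2) := Real.one_le_exp (by linarith)
  have b1 : x ^ (J + 1) ≤ Real.exp x := by
    calc x ^ (J + 1) ≤ x ^ (J + 2) := pow_le_pow_right₀ h5 (by omega)
      _ ≤ Real.exp (x / 2) := hE
      _ ≤ Real.exp x := Real.exp_le_exp.mpr (by linarith)
  rw [Real.exp_neg, inv_mul_le_iff₀ (Real.exp_pos x)]
  refine key.trans ?_
  have c1 : 1 ≤ Real.exp x * (1 / x ^ (J + 1)) := by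
    rw [mul_one_div, one_le_div (by positivity)]; exact b1
  have c2 : 2 * √z * Real.log z ≤ 4 * Real.exp (-s / 2) * (Real.exp x * (1 / x ^ (J + 1))) := by
    have d : x * Real.exp (x / 2) ≤ Real.exp x * (1 / x ^ (J + 1)) := by
      rw [mul_one_div, le_div_iff₀ (by positivity), hexp]
      calc _ = x ^ (J + 2) * Real.exp (x / 2) := by ring
        _ ≤ _ := by gcongr
    rw [hsz, hlz]
    calc _ ≤ 2 * (Real.exp (-s / 2) * Real.exp (x / 2)) * (2 * x) := by gcongr; linarith
      _ = 4 * Real.exp (-s / 2) * (x * Real.exp (x / 2)) := by ring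
      _ ≤ _ := by gcongr
  calc _ ≤ 4 * Real.exp (-s / 2) * (Real.exp x * (1 / x ^ (J + 1))) +
        C * (Real.exp x * (1 / x ^ (J + 1))) + Real.exp x * (1 / x ^ (J + 1)) := by
        rw [mul_one_div] at *
        gcongr
    _ = _ := by ring

theorem isLittleO_one_div_pow_succ (N : ℕ) :
    (fun x : ℝ ↦ 1 / x ^ (N + 1)) =o[atTop] fun x : ℝ ↦ 1 / x ^ N := by
  have h := (Asymptotics.isBigO_refl (fun x : ℝ ↦ 1 / x ^ N) atTop).mul_isLittleO
    ((Asymptotics.isLittleO_one_iff ℝ).mpr tendsto_inv_atTop_zero)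
  refine h.congr (fun x ↦ ?_) fun x ↦ by rw [mul_one]
  rw [pow_succ, one_div, one_div, mul_inv]

theorem isLittleO_exp_neg_mul_primePi_sub_sum {s t : ℝ} (hst : s < t) (N : ℕ) :
    (fun x : ℝ ↦
        Real.exp (-x) * (primePi (Real.exp (x - s)) - primePi (Real.exp (x - t)))
          - ∑ n ∈ Finset.range (N + 1), (∫ u in s..t, u ^ n * Real.exp (-u)) / x ^ (n + 1))
      =o[atTop] fun x : ℝ ↦ 1 / x ^ (N + 1) := by
  have h := ((isBigO_exp_neg_mul_primePi_sub_integral hst N.succ_ne_zero).add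
    (isBigO_integral_exp_neg_div_sub_sub_sum hst (N + 1))).trans_isLittleO
      (isLittleO_one_div_pow_succ (N + 1))
  exact h.congr_left fun x ↦ by ring

theorem integral_exp_neg_interval (s t : ℝ) :
    ∫ u in s..t, Real.exp (-u) = Real.exp (-s) - Real.exp (-t) := by
  rw [intervalIntegral.integral_eq_sub_of_hasDerivAt (f := fun u ↦ -Real.exp (-u)) (fun u _ ↦ by
    simpa using! (hasDerivAt_neg u).exp.neg) (Continuous.intervalIntegrable (by fun_prop) _ _)]
  ring

theorem integral_mul_exp_neg_interval (s t : ℝ) :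
    ∫ u in s..t, u * Real.exp (-u) = Real.exp (-s) * (1 + s) - Real.exp (-t) * (1 + t) := by
  rw [intervalIntegral.integral_eq_sub_of_hasDerivAt (f := fun u ↦ -(Real.exp (-u) * (1 + u)))
    (fun u _ ↦ by
      refine ((hasDerivAt_neg u).exp.mul ((hasDerivAt_id u).const_add 1)).neg.congr_deriv ?_
      simp only [id]
      ring) (Continuous.intervalIntegrable (by fun_prop) _ _)]
  ring

theorem isLittleO_primePi_mul_log_div_sub {s t : ℝ} (hst : s < t) :
    (fun x : ℝ ↦
        (primePi (Real.exp (-s) * x) - primePi (Real.exp (-t) * x)) * Real.log x / x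
          - (Real.exp (-s) - Real.exp (-t))
          - (Real.exp (-s) * (1 - Real.log (Real.exp (-s)))
              - Real.exp (-t) * (1 - Real.log (Real.exp (-t)))) / Real.log x)
      =o[atTop] fun x : ℝ ↦ 1 / Real.log x := by
  have h := (Asymptotics.isBigO_refl Real.log atTop).mul_isLittleO
    ((isLittleO_exp_neg_mul_primePi_sub_sum hst 1).comp_tendsto Real.tendsto_log_atTop)
  have hpos : ∀ᶠ x : ℝ in atTop, 0 < x ∧ 0 < Real.log x := by
    filter_upwards [eventually_gt_atTop 1] with x hx
    exact ⟨by linarith, Real.log_pos hx⟩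
  refine h.congr' ?_ ?_
  · filter_upwards [hpos] with x ⟨hx, hl⟩
    have hexp : ∀ v, Real.exp (Real.log x - v) = Real.exp (-v) * x := fun v ↦ by
      rw [sub_eq_add_neg, Real.exp_add, Real.exp_log hx, mul_comm]
    simp only [Function.comp, Finset.sum_range_succ, Finset.sum_range_zero, pow_zero, pow_one,
      one_mul, zero_add, integral_exp_neg_interval, integral_mul_exp_neg_interval, hexp,
      Real.exp_neg (Real.log x), Real.exp_log hx, Real.log_exp]
    field_simp
    ring
  · filter_upwards [hpos] with x ⟨hx, hl⟩
    simp only [Function.comp]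
    field_simp

end

/-- Let `s < t` and `m_n = ∫_s^t u^n·e^{−u} du`.  Then for every `N ≥ 0`,
`e^{−x}·(π(e^{x−s}) − π(e^{x−t})) − ∑_{n=0}^{N} m_n/x^{n+1} = o(1/x^{N+1})` as `x → ∞`;
in particular, with `a = e^{−s}` and `b = e^{−t}`,
`(π(ax) − π(bx))·(log x)/x − (a − b) − (a(1 − log a) − b(1 − log b))/log x = o(1/log x)`. -/
theorem primePi_interval_asymptotic_expansion (s t : ℝ) (hst : s < t) :
    (∀ N : ℕ,
      (fun x : ℝ =>
          Real.exp (-x) * (primePi (Real.exp (x - s)) - primePi (Real.exp (x - t)))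
            - ∑ n ∈ Finset.range (N + 1), (∫ u in s..t, u ^ n * Real.exp (-u)) / x ^ (n + 1))
        =o[atTop] fun x : ℝ => 1 / x ^ (N + 1)) ∧
    (fun x : ℝ =>
        (primePi (Real.exp (-s) * x) - primePi (Real.exp (-t) * x)) * Real.log x / x
          - (Real.exp (-s) - Real.exp (-t))
          - (Real.exp (-s) * (1 - Real.log (Real.exp (-s)))
              - Real.exp (-t) * (1 - Real.log (Real.exp (-t)))) / Real.log x)
      =o[atTop] fun x : ℝ => 1 / Real.log x := by
  exact ⟨isLittleO_exp_neg_mul_primePi_sub_sum hst, isLittleO_primePi_mul_log_div_sub hst⟩
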